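/- arXiv:2008.06088 — 4 statements merged into one kernel-verified Lean document; each statement's English description precedes it below -/
import Mathlib

section
/- Let r > 2, θ ∈ ℝ, σ > 0, μ ∈ ℝ. Then for every x ≠ μ, the variance-gamma density satisfies p(x) ≤ (Γ((r−1)/2)/(2σ√π·Γ(r/2)))·(σ²/(θ²+σ²))^{(r−1)/2}·exp(θ²(r−2)/σ²). -/
open MeasureTheory Real Filter

/-- Modified Bessel function of the second kind. -/
noncomputable def besselK (ν x : ℝ) : ℝ :=
  ∫ t in Set.Ioi (0:ℝ), Real.exp (-x * Real.cosh t) * Real.cosh (ν * t)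

/-- The VG(r,θ,σ,μ) density. -/
noncomputable def vgDensity (r θ σ μ x : ℝ) : ℝ :=
  (σ * Real.sqrt Real.pi * Real.Gamma (r / 2))⁻¹ * Real.exp (θ * (x - μ) / σ ^ 2) *
    (|x - μ| / (2 * Real.sqrt (θ ^ 2 + σ ^ 2))) ^ ((r - 1) / 2) *
    besselK ((r - 1) / 2) (Real.sqrt (θ ^ 2 + σ ^ 2) * |x - μ| / σ ^ 2)

noncomputable def vgW (ν z t : ℝ) : ℝ := Real.exp (-z * Real.cosh t + ν * t)

noncomputable def vgN (ν z : ℝ) : ℝ := ∫ t, vgW ν z t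

lemma vgW_pos (ν z t : ℝ) : 0 < vgW ν z t := Real.exp_pos _

lemma vgW_cont (ν z : ℝ) : Continuous (vgW ν z) := by
  unfold vgW
  have := Real.continuous_cosh
  fun_prop

lemma gam_integral {ν c : ℝ} (hν : 0 < ν) (hc : 0 < c) :
    ∫ t : ℝ, Real.exp (-c * Real.exp t + ν * t) = (1 / c) ^ ν * Real.Gamma ν := by
  rw [← Real.integral_rpow_mul_exp_neg_mul_Ioi hν hc, ← Real.range_exp, ← Set.image_univ,
    integral_image_eq_integral_abs_deriv_smul MeasurableSet.univ
      (fun x _ => (Real.hasDerivAt_exp x).hasDerivWithinAt) Real.exp_injective.injOn,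
    setIntegral_univ]
  refine integral_congr_ae (ae_of_all _ fun t => ?_)
  simp only [smul_eq_mul, abs_of_pos (Real.exp_pos t)]
  rw [← Real.exp_mul, ← Real.exp_add, ← Real.exp_add]
  congr 1; ring

lemma gam_integrable {ν c : ℝ} (hν : 0 < ν) (hc : 0 < c) :
    Integrable (fun t : ℝ => Real.exp (-c * Real.exp t + ν * t)) := by
  by_contra h
  have h1 := integral_undef h
  rw [gam_integral hν hc] at h1
  have := Real.Gamma_pos_of_pos hν
  have : 0 < (1 / c) ^ ν := by positivity
  have : 0 < (1 / c) ^ ν * Real.Gamma ν := by positivity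
  linarith

lemma vgW_integrable (ν : ℝ) {z : ℝ} (hz : 0 < z) : Integrable (vgW ν z) := by
  have hk : 0 < |ν| + 1 := by positivity
  have h1 := gam_integrable hk (half_pos hz)
  have h2 := h1.comp_neg
  refine (h1.add h2).mono' (vgW_cont ν z).aestronglyMeasurable (ae_of_all _ fun t => ?_)
  rw [Real.norm_of_nonneg (vgW_pos ν z t).le]
  simp only [vgW, Pi.add_apply, Real.cosh_eq]
  have e1 := Real.exp_pos t
  have e2 := Real.exp_pos (-t)
  rcases le_total 0 t with ht | ht
  · have : ν * t ≤ (|ν| + 1) * t := by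
      apply mul_le_mul_of_nonneg_right _ ht
      linarith [le_abs_self ν]
    have h3 : Real.exp (-z * ((Real.exp t + Real.exp (-t)) / 2) + ν * t) ≤
        Real.exp (-(z / 2) * Real.exp t + (|ν| + 1) * t) := by
      apply Real.exp_le_exp.2
      nlinarith [mul_pos hz e2]
    have := Real.exp_pos (-(z / 2) * Real.exp (-t) + (|ν| + 1) * -t)
    linarith
  · have : ν * t ≤ (|ν| + 1) * -t := by
      have := neg_abs_le ν
      nlinarith
    have h3 : Real.exp (-z * ((Real.exp t + Real.exp (-t)) / 2) + ν * t) ≤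
        Real.exp (-(z / 2) * Real.exp (-t) + (|ν| + 1) * -t) := by
      apply Real.exp_le_exp.2
      nlinarith [mul_pos hz e1]
    have := Real.exp_pos (-(z / 2) * Real.exp t + (|ν| + 1) * t)
    linarith

lemma vgN_pos (ν : ℝ) {z : ℝ} (hz : 0 < z) : 0 < vgN ν z := by
  unfold vgN
  rw [integral_pos_iff_support_of_nonneg (fun t => (vgW_pos ν z t).le) (vgW_integrable ν hz)]
  have : Function.support (vgW ν z) = Set.univ := by
    ext t; simp [(vgW_pos ν z t).ne']
  rw [this]; simp

lemma vgW_shift (ν s z t : ℝ) : vgW (ν + s) z t = vgW ν z t * Real.exp (s * t) := by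
  unfold vgW; rw [← Real.exp_add]; congr 1; ring

lemma vgN_le {ν z : ℝ} (hν : 0 < ν) (hz : 0 < z) :
    vgN ν z ≤ (2 / z) ^ ν * Real.Gamma ν := by
  have := gam_integral hν (half_pos hz)
  rw [one_div_div] at this
  rw [← this]
  refine integral_mono (vgW_integrable ν hz) (gam_integrable hν (half_pos hz)) fun t => ?_
  apply Real.exp_le_exp.2
  rw [Real.cosh_eq]
  nlinarith [mul_pos hz (Real.exp_pos (-t))]

lemma besselK_eq (ν : ℝ) {z : ℝ} (hz : 0 < z) : besselK ν z = vgN ν z / 2 := by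
  have h := integral_comp_abs (f := fun t => Real.exp (-z * Real.cosh t) * Real.cosh (ν * t))
  have h2 : ∫ t : ℝ, Real.exp (-z * Real.cosh |t|) * Real.cosh (ν * |t|) = vgN ν z := by
    have h3 : vgN ν z = ∫ t, vgW ν z (-t) := (integral_neg_eq_self (vgW ν z) volume).symm
    have h4 : vgN ν z = (∫ t, (vgW ν z t + vgW ν z (-t))) / 2 := by
      rw [integral_add (vgW_integrable ν hz) (vgW_integrable ν hz).comp_neg, ← h3]
      change _ = (vgN ν z + vgN ν z) / 2
      ring
    rw [h4, ← integral_div]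
    refine integral_congr_ae (ae_of_all _ fun t => ?_)
    have : Real.cosh (ν * |t|) = Real.cosh (ν * t) := by
      rcases abs_choice t with h | h <;> rw [h]
      rw [mul_neg, Real.cosh_neg]
    simp only [Real.cosh_abs, this, vgW, Real.cosh_neg]
    rw [Real.cosh_eq (ν * t), Real.exp_add, Real.exp_add, mul_neg]
    ring
  unfold besselK
  rw [← h2, h]; ring

/-- derivative in z -/
lemma vgN_hasDerivAt (ν : ℝ) {z : ℝ} (hz : 0 < z) :
    HasDerivAt (vgN ν) (-(vgN (ν + 1) z + vgN (ν - 1) z) / 2) z := by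
  have key : ∀ (w t : ℝ), -Real.cosh t * vgW ν w t
      = -(vgW (ν + 1) w t + vgW (ν - 1) w t) / 2 := by
    intro w t
    rw [sub_eq_add_neg, vgW_shift, vgW_shift, Real.cosh_eq, one_mul, neg_one_mul]
    ring
  have hz2 := half_pos hz
  have := hasDerivAt_integral_of_dominated_loc_of_deriv_le (μ := volume) (F := fun w t => vgW ν w t)
    (F' := fun w t => -Real.cosh t * vgW ν w t) (x₀ := z) (s := Set.Ioi (z / 2))
    (bound := fun t => (vgW (ν + 1) (z / 2) t + vgW (ν - 1) (z / 2) t) / 2)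
    (Ioi_mem_nhds (by linarith)) (Eventually.of_forall fun w => (vgW_cont ν w).aestronglyMeasurable)
    (vgW_integrable ν hz)
    ((Real.continuous_cosh.neg.mul (vgW_cont ν z)).aestronglyMeasurable)
    (ae_of_all _ fun t w hw => by
      have e : (vgW (ν + 1) (z / 2) t + vgW (ν - 1) (z / 2) t) / 2
        = Real.cosh t * vgW ν (z / 2) t := by linarith [key (z / 2) t]
      simp only [e]
      rw [norm_mul, norm_neg, Real.norm_of_nonneg (Real.cosh_pos t).le,
        Real.norm_of_nonneg (vgW_pos _ _ _).le]
      apply mul_le_mul_of_nonneg_left _ (Real.cosh_pos t).le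
      apply Real.exp_le_exp.2
      have : z / 2 < w := hw
      nlinarith [Real.cosh_pos t])
    (((vgW_integrable _ hz2).add (vgW_integrable _ hz2)).div_const 2)
    (ae_of_all _ fun t w hw => by
      have : HasDerivAt (fun w => -w * Real.cosh t + ν * t) (-1 * Real.cosh t) w :=
        (((hasDerivAt_id w).neg).mul_const _).add_const _
      have := this.exp
      exact this.congr_deriv (by simp only [vgW]; ring))
  have h := this.2
  have e : ∫ t, -Real.cosh t * vgW ν z t = -(vgN (ν + 1) z + vgN (ν - 1) z) / 2 := by
    simp only [key]
    rw [integral_div, integral_neg, integral_add (vgW_integrable _ hz) (vgW_integrable _ hz)]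
    rfl
  rw [e] at h
  exact h

lemma vgW_hasDerivAt (ν z t : ℝ) :
    HasDerivAt (vgW ν z) (vgW ν z t * (-z * Real.sinh t + ν)) t := by
  have : HasDerivAt (fun t => -z * Real.cosh t + ν * t) (-z * Real.sinh t + ν * 1) t :=
    ((Real.hasDerivAt_cosh t).const_mul _).add ((hasDerivAt_id t).const_mul _)
  have := this.exp
  rwa [mul_one] at this

lemma vgN_rec (ν : ℝ) {z : ℝ} (hz : 0 < z) :
    z * (vgN (ν + 1) z - vgN (ν - 1) z) = 2 * ν * vgN ν z := by
  have key : ∀ t, vgW ν z t * (-z * Real.sinh t + ν) =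
      ν * vgW ν z t - z / 2 * (vgW (ν + 1) z t - vgW (ν - 1) z t) := by
    intro t
    rw [sub_eq_add_neg ν, vgW_shift, vgW_shift, Real.sinh_eq, one_mul, neg_one_mul]
    ring
  have i1 := (vgW_integrable ν hz).const_mul ν
  have i2 : Integrable (fun t => z / 2 * (vgW (ν + 1) z t - vgW (ν - 1) z t)) :=
    ((vgW_integrable (ν + 1) hz).sub (vgW_integrable (ν - 1) hz)).const_mul (z / 2)
  have h := integral_eq_zero_of_hasDerivAt_of_integrable (vgW_hasDerivAt ν z)
    (by simp only [key]; exact i1.sub i2) (vgW_integrable ν hz)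
  simp only [key] at h
  rw [integral_sub i1 i2, integral_const_mul, integral_const_mul] at h
  rw [integral_sub (vgW_integrable (ν + 1) hz) (vgW_integrable (ν - 1) hz)] at h
  change ν * vgN ν z - z / 2 * (vgN (ν + 1) z - vgN (ν - 1) z) = 0 at h
  linarith

/-- Segura-type bound. -/
lemma vgN_segura {a z : ℝ} (ha : 0 < a) (hz : 0 < z) :
    z * (vgN (a + 1 / 2) z ^ 2 - vgN (a - 1 / 2) z ^ 2)
      ≤ 2 * a * (vgN (a + 1 / 2) z * vgN (a - 1 / 2) z) := by
  set P := vgN (a + 1 / 2) z with hP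
  set Q := vgN (a - 1 / 2) z with hQ
  have hPpos : 0 < P := vgN_pos _ hz
  have hQpos : 0 < Q := vgN_pos _ hz
  let c : ℝ → ℝ := fun t => Real.cosh (t / 2)
  let s : ℝ → ℝ := fun t => Real.sinh (t / 2)
  have hc1 : ∀ t, 1 ≤ c t := fun t => Real.one_le_cosh _
  have hc0 : ∀ t, 0 < c t := fun t => Real.cosh_pos _
  have hcs : ∀ t, c t ^ 2 = 1 + s t ^ 2 := fun t => by
    have := Real.cosh_sq (t / 2); simp only [c, s]; linarith
  have cc : Continuous c := Real.continuous_cosh.comp (by fun_prop)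
  have cs : Continuous s := Real.continuous_sinh.comp (by fun_prop)
  let W := vgW a z
  have iP := vgW_integrable (a + 1 / 2) hz
  have iQ := vgW_integrable (a - 1 / 2) hz
  have iW : Integrable W := vgW_integrable a hz
  have eC : ∀ t, 2 * (W t * c t) = vgW (a + 1 / 2) z t + vgW (a - 1 / 2) z t := by
    intro t
    rw [sub_eq_add_neg, vgW_shift, vgW_shift]
    simp only [c, W]; rw [Real.cosh_eq]
    rw [show (1 / 2 * t) = t / 2 by ring, show (-(1 / 2) * t) = -(t / 2) by ring]
    ring
  have eS : ∀ t, 2 * (W t * s t) = vgW (a + 1 / 2) z t - vgW (a - 1 / 2) z t := by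
    intro t
    rw [sub_eq_add_neg a, vgW_shift, vgW_shift]
    simp only [s, W]; rw [Real.sinh_eq]
    rw [show (1 / 2 * t) = t / 2 by ring, show (-(1 / 2) * t) = -(t / 2) by ring]
    ring
  have iC2 : Integrable (fun t => 2 * (W t * c t)) := by simp only [eC]; exact iP.add iQ
  have iS2 : Integrable (fun t => 2 * (W t * s t)) := by simp only [eS]; exact iP.sub iQ
  have vC : ∫ t, 2 * (W t * c t) = P + Q := by
    simp only [eC]; exact integral_add iP iQ
  have vS : ∫ t, 2 * (W t * s t) = P - Q := by
    simp only [eS]; exact integral_sub iP iQ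
  have hWpos : ∀ t, 0 < W t := fun t => vgW_pos _ _ _
  have cW : Continuous W := vgW_cont a z
  have iI : Integrable (fun t => W t / c t) := by
    refine iW.mono' (cW.div cc fun t => (hc0 t).ne').aestronglyMeasurable (ae_of_all _ fun t => ?_)
    rw [Real.norm_of_nonneg (div_pos (hWpos t) (hc0 t)).le]
    exact div_le_self (hWpos t).le (hc1 t)
  have iJ : Integrable (fun t => W t * s t / c t ^ 2) := by
    refine iW.mono' ((cW.mul cs).div (cc.pow 2) fun t => (pow_pos (hc0 t) 2).ne').aestronglyMeasurable
      (ae_of_all _ fun t => ?_)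
    rw [norm_div, norm_mul, Real.norm_of_nonneg (hWpos t).le,
      Real.norm_of_nonneg (pow_pos (hc0 t) 2).le, Real.norm_eq_abs, div_le_iff₀ (pow_pos (hc0 t) 2)]
    apply mul_le_mul_of_nonneg_left _ (hWpos t).le
    rw [hcs t, ← sq_abs (s t)]
    nlinarith [sq_nonneg (|s t| - 1)]
  set I := ∫ t, W t / c t with hI
  set J := ∫ t, W t * s t / c t ^ 2 with hJ
  -- symmetrization
  have hJ0 : 0 ≤ J := by
    have h3 : J = ∫ t, (fun t => W t * s t / c t ^ 2) (-t) :=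
      (integral_neg_eq_self (fun t => W t * s t / c t ^ 2) volume).symm
    have h4 : 2 * J = ∫ t, ((fun t => W t * s t / c t ^ 2) t
        + (fun t => W t * s t / c t ^ 2) (-t)) := by
      rw [integral_add iJ iJ.comp_neg, ← h3]; simp only [← hJ]; ring
    have : 0 ≤ 2 * J := by
      rw [h4]
      refine integral_nonneg fun t => ?_
      have e1 : s (-t) = - s t := by simp only [s]; rw [neg_div, Real.sinh_neg]
      have e2 : c (-t) = c t := by simp only [c]; rw [neg_div, Real.cosh_neg]
      simp only [e1, e2, Pi.zero_apply]
      rw [← add_div]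
      apply div_nonneg _ (sq_nonneg _)
      rw [show W t * s t + W (-t) * -s t = (W t - W (-t)) * s t by ring]
      rcases le_total 0 t with ht | ht
      · apply mul_nonneg
        · rw [sub_nonneg]; apply Real.exp_le_exp.2
          rw [Real.cosh_neg]; nlinarith
        · exact Real.sinh_nonneg_iff.2 (by linarith)
      · apply mul_nonneg_of_nonpos_of_nonpos
        · rw [sub_nonpos]; apply Real.exp_le_exp.2
          rw [Real.cosh_neg]; nlinarith
        · exact Real.sinh_nonpos_iff.2 (by linarith)
    linarith
  -- integration by parts
  have hibp : z * (P - Q) = a * I - J / 2 := by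
    have hd : ∀ t, HasDerivAt (fun t => W t / c t)
        (a * (W t / c t) - z * (2 * (W t * s t)) - (W t * s t / c t ^ 2) / 2) t := by
      intro t
      have h1 : HasDerivAt c (s t * (1 / 2)) t :=
        ((hasDerivAt_id t).div_const 2).cosh
      have h2 := (vgW_hasDerivAt a z t).div h1 (hc0 t).ne'
      refine h2.congr_deriv ?_
      have : Real.sinh t = 2 * s t * c t := by
        rw [show t = 2 * (t / 2) by ring, Real.sinh_two_mul]; simp [s, c]
      rw [this]
      have := (hc0 t).ne'
      change (W t * _ * _ - W t * _) / _ = _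
      field_simp
      ring
    have h := integral_eq_zero_of_hasDerivAt_of_integrable hd
      (((iI.const_mul a).sub (iS2.const_mul z)).sub (iJ.div_const 2)) iI
    have i3 : Integrable (fun t => a * (W t / c t) - z * (2 * (W t * s t))) :=
      (iI.const_mul a).sub (iS2.const_mul z)
    rw [integral_sub i3 (iJ.div_const 2),
      integral_sub (iI.const_mul a) (iS2.const_mul z), integral_const_mul, integral_const_mul,
      integral_div, vS] at h
    linarith
  -- Cauchy-Schwarz
  have hCS : ∀ l : ℝ, 0 ≤ (P + Q - 2 * I) - 2 * l * (P - Q) + l ^ 2 * (P + Q) := by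
    intro l
    have h : (P + Q - 2 * I) - 2 * l * (P - Q) + l ^ 2 * (P + Q) =
        ∫ t, (2 * (W t * c t) - 2 * (W t / c t) - 2 * l * (2 * (W t * s t))
          + l ^ 2 * (2 * (W t * c t))) := by
      have i3 : Integrable (fun t => 2 * (W t * c t) - 2 * (W t / c t)) :=
        iC2.sub (iI.const_mul 2)
      have i4 : Integrable (fun t => 2 * (W t * c t) - 2 * (W t / c t)
          - 2 * l * (2 * (W t * s t))) := i3.sub (iS2.const_mul _)
      rw [integral_add i4 (iC2.const_mul _),
        integral_sub i3 (iS2.const_mul _),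
        integral_sub iC2 (iI.const_mul 2), vC, integral_const_mul, integral_const_mul,
        vS, integral_const_mul, vC]
    rw [h]
    refine integral_nonneg fun t => ?_
    have h0 := (hc0 t).ne'
    have : (2 * (W t * c t) - 2 * (W t / c t) - 2 * l * (2 * (W t * s t))
          + l ^ 2 * (2 * (W t * c t))) = 2 * W t / c t * (s t - l * c t) ^ 2 := by
      have e : s t ^ 2 = c t ^ 2 - 1 := by linarith [hcs t]
      rw [sub_sq, e]
      field_simp
    simp only [Pi.zero_apply]
    rw [this]
    have := hWpos t
    have := hc0 t
    positivity
  have hS : 0 < P + Q := by linarith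
  have h1 : (P - Q) ^ 2 ≤ (P + Q) * (P + Q - 2 * I) := by
    have := mul_nonneg hS.le (hCS ((P - Q) / (P + Q)))
    have e : (P + Q) * ((P + Q - 2 * I) - 2 * ((P - Q) / (P + Q)) * (P - Q)
      + ((P - Q) / (P + Q)) ^ 2 * (P + Q)) = (P + Q) * (P + Q - 2 * I) - (P - Q) ^ 2 := by
      field_simp; ring
    linarith
  have h2 : z * (P - Q) ≤ a * I := by linarith
  nlinarith [mul_le_mul_of_nonneg_right h2 hS.le, mul_le_mul_of_nonneg_left h1 ha.le]

lemma vg_key {ν β z : ℝ} (hν : 1 / 2 < ν) (hβ0 : 0 ≤ β) (hβ1 : β < 1) (hz : 0 < z) :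
    Real.exp (β * z) * z ^ ν * vgN ν z
      ≤ 2 ^ ν * Real.Gamma ν * Real.exp ((2 * ν - 1) * β ^ 2 / (1 - β ^ 2)) := by
  have hb : 0 < 1 - β ^ 2 := by nlinarith
  have hν0 : 0 < ν := by linarith
  set z0 := (2 * ν - 1) * β / (1 - β ^ 2) with hz0
  have ez : (2 * ν - 1) * β ^ 2 / (1 - β ^ 2) = β * z0 := by rw [hz0]; ring
  rw [ez]
  have small : ∀ w, 0 < w → β * w ≤ β * z0 → Real.exp (β * w) * w ^ ν * vgN ν w
      ≤ 2 ^ ν * Real.Gamma ν * Real.exp (β * z0) := by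
    intro w hw hle
    have h1 : w ^ ν * vgN ν w ≤ 2 ^ ν * Real.Gamma ν := by
      have := mul_le_mul_of_nonneg_left (vgN_le hν0 hw) (rpow_pos_of_pos hw ν).le
      rw [Real.div_rpow zero_le_two hw.le] at this
      have h0 := (rpow_pos_of_pos hw ν).ne'
      calc _ ≤ _ := this
        _ = _ := by field_simp
    have h2 := Real.exp_le_exp.2 hle
    have h3 := vgN_pos ν hw
    calc _ = (w ^ ν * vgN ν w) * Real.exp (β * w) := by ring
      _ ≤ _ := by gcongr
  rcases le_or_gt (β * z) (β * z0) with h | h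
  · exact small z hz h
  have hβ : 0 < β := by
    rcases hβ0.eq_or_lt with h' | h'
    · rw [← h'] at h; simp at h
    · exact h'
  have hzz : z0 < z := lt_of_mul_lt_mul_left h hβ0
  have hz0p : 0 < z0 := by
    apply div_pos _ hb; apply mul_pos _ hβ; linarith
  refine le_trans ?_ (small z0 hz0p le_rfl)
  have hd : ∀ w, 0 < w → HasDerivAt (fun w => Real.exp (β * w) * w ^ ν * vgN ν w)
      (Real.exp (β * w) * w ^ ν * (β * vgN ν w - vgN (ν - 1) w)) w := by
    intro w hw
    have h1 : HasDerivAt (fun w => Real.exp (β * w)) (Real.exp (β * w) * (β * 1)) w :=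
      ((hasDerivAt_id w).const_mul β).exp
    have h2 := Real.hasDerivAt_rpow_const (x := w) (p := ν) (Or.inl hw.ne')
    have h3 := (h1.mul h2).mul (vgN_hasDerivAt ν hw)
    refine h3.congr_deriv ?_
    rw [Real.rpow_sub_one hw.ne']
    have h4 := vgN_rec ν hw
    have h5 : vgN (ν + 1) w = 2 * ν * vgN ν w / w + vgN (ν - 1) w := by
      field_simp; linarith
    rw [h5]
    simp only [Pi.mul_apply]
    field_simp
    ring
  have anti : AntitoneOn (fun w => Real.exp (β * w) * w ^ ν * vgN ν w) (Set.Ici z0) := by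
    apply antitoneOn_of_deriv_nonpos (convex_Ici z0)
    · intro w hw
      exact (hd w (lt_of_lt_of_le hz0p hw)).continuousAt.continuousWithinAt
    · intro w hw
      rw [interior_Ici] at hw
      exact (hd w (hz0p.trans hw)).differentiableAt.differentiableWithinAt
    · intro w hw
      rw [interior_Ici] at hw
      have hw0 : 0 < w := hz0p.trans hw
      rw [(hd w hw0).deriv]
      apply mul_nonpos_of_nonneg_of_nonpos
      · positivity
      have seg := vgN_segura (a := ν - 1 / 2) (by linarith) hw0
      rw [show ν - 1 / 2 + 1 / 2 = ν by ring, show ν - 1 / 2 - 1 / 2 = ν - 1 by ring] at seg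
      have p1 := vgN_pos ν hw0
      have p2 := vgN_pos (ν - 1) hw0
      by_contra hcon
      push Not at hcon
      have hw' : (2 * ν - 1) * β ≤ w * (1 - β ^ 2) := by
        have : z0 < w := hw
        rw [hz0, div_lt_iff₀ hb] at this
        exact this.le
      generalize vgN ν w = P at *
      generalize vgN (ν - 1) w = Q at *
      have hQ : Q < β * P := by linarith
      have a1 : Q ^ 2 < (β * P) ^ 2 := by gcongr
      have a2 := mul_lt_mul_of_pos_left a1 hw0
      have a3 := mul_le_mul_of_nonneg_right hw' (sq_nonneg P)
      have a4 : (2 * ν - 1) * (P * Q) ≤ (2 * ν - 1) * (P * (β * P)) := by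
        apply mul_le_mul_of_nonneg_left _ (by linarith)
        exact mul_le_mul_of_nonneg_left hQ.le p1.le
      nlinarith
  exact anti (Set.mem_Ici.2 le_rfl) (Set.mem_Ici.2 hzz.le) hzz.le

theorem vg_density_bound (r θ σ μ : ℝ) (hr : 2 < r) (hσ : 0 < σ) :
    ∀ x : ℝ, x ≠ μ →
      vgDensity r θ σ μ x ≤
        Real.Gamma ((r - 1) / 2) / (2 * σ * Real.sqrt Real.pi * Real.Gamma (r / 2)) *
          (σ ^ 2 / (θ ^ 2 + σ ^ 2)) ^ ((r - 1) / 2) * Real.exp (θ ^ 2 * (r - 2) / σ ^ 2) := by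
  intro x hx
  have hy : 0 < |x - μ| := abs_pos.2 (sub_ne_zero.2 hx)
  have hq : 0 < θ ^ 2 + σ ^ 2 := by positivity
  have hs : 0 < Real.sqrt (θ ^ 2 + σ ^ 2) := Real.sqrt_pos.2 hq
  have hs2 : Real.sqrt (θ ^ 2 + σ ^ 2) ^ 2 = θ ^ 2 + σ ^ 2 := Real.sq_sqrt hq.le
  unfold vgDensity
  set s := Real.sqrt (θ ^ 2 + σ ^ 2) with hsdef
  set y := |x - μ| with hydef
  set z := s * y / σ ^ 2 with hzdef
  have hz : 0 < z := by positivity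
  set ν := (r - 1) / 2 with hν
  rw [besselK_eq ν hz]
  have hβ1 : |θ| / s < 1 := by
    rw [div_lt_one hs, hsdef]
    apply Real.lt_sqrt_of_sq_lt
    rw [sq_abs]; nlinarith
  have key := vg_key (ν := ν) (β := |θ| / s) (z := z) (by rw [hν]; linarith) (by positivity) hβ1 hz
  have e1 : (2 * ν - 1) * (|θ| / s) ^ 2 / (1 - (|θ| / s) ^ 2) = θ ^ 2 * (r - 2) / σ ^ 2 := by
    rw [div_pow, sq_abs, hs2, hν]
    have : 1 - θ ^ 2 / (θ ^ 2 + σ ^ 2) = σ ^ 2 / (θ ^ 2 + σ ^ 2) := by field_simp; ring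
    rw [this]
    field_simp
    ring
  rw [e1] at key
  have e2 : Real.exp (θ * (x - μ) / σ ^ 2) ≤ Real.exp (|θ| / s * z) := by
    apply Real.exp_le_exp.2
    have : |θ| / s * z = |θ| * y / σ ^ 2 := by rw [hzdef]; field_simp
    rw [this, hydef, ← abs_mul]
    gcongr
    exact le_abs_self _
  have e3 : (y / (2 * s)) ^ ν = (σ ^ 2 / (θ ^ 2 + σ ^ 2)) ^ ν * z ^ ν / 2 ^ ν := by
    rw [← Real.mul_rpow (by positivity) hz.le, ← Real.div_rpow (by positivity) zero_le_two]
    congr 1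
    rw [hzdef, ← hs2]; field_simp
  rw [e3]
  have hG : 0 < Real.Gamma (r / 2) := Real.Gamma_pos_of_pos (by linarith)
  have hpi : 0 < Real.sqrt Real.pi := Real.sqrt_pos.2 Real.pi_pos
  have hN := vgN_pos ν hz
  have h2 : (0:ℝ) < 2 ^ ν := rpow_pos_of_pos two_pos ν
  set A := (σ ^ 2 / (θ ^ 2 + σ ^ 2)) ^ ν with hA
  have hA0 : 0 < A := rpow_pos_of_pos (by positivity) _
  have hzν : 0 < z ^ ν := rpow_pos_of_pos hz _
  calc (σ * √π * Real.Gamma (r / 2))⁻¹ * Real.exp (θ * (x - μ) / σ ^ 2) * (A * z ^ ν / 2 ^ ν)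
        * (vgN ν z / 2)
      ≤ (σ * √π * Real.Gamma (r / 2))⁻¹ * Real.exp (|θ| / s * z) * (A * z ^ ν / 2 ^ ν)
        * (vgN ν z / 2) := by gcongr
    _ = (σ * √π * Real.Gamma (r / 2))⁻¹ * A / 2 ^ ν / 2 *
        (Real.exp (|θ| / s * z) * z ^ ν * vgN ν z) := by ring
    _ ≤ (σ * √π * Real.Gamma (r / 2))⁻¹ * A / 2 ^ ν / 2 *
        (2 ^ ν * Real.Gamma ν * Real.exp (θ ^ 2 * (r - 2) / σ ^ 2)) := by gcongr
    _ = _ := by field_simp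
end

section
/- Let r > 3, θ ≠ 0, σ > 0, μ ∈ ℝ. Then for every x ≠ μ, the variance-gamma density satisfies the strict inequality p(x) < (1/(σ√π·Γ(r/2)))·exp(θ²(r−2)/σ²)·(|θ|(r−3)/(2√(θ²+σ²)))^{(r−1)/2}·K_{(r−1)/2}(|θ|√(θ²+σ²)(r−3)/σ²). -/
open MeasureTheory Real Filter

lemma iadd {f g : ℝ → ℝ} {m : Measure ℝ} (hf : Integrable f m) (hg : Integrable g m) :
    Integrable (fun x => f x + g x) m := hf.add hg

lemma bk_bound (ν z t : ℝ) (hz : 0 < z) (ht : 0 ≤ t) :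
    Real.exp (-z * Real.cosh t) * Real.cosh (ν * t) ≤
      Real.exp ((|ν| + 1) ^ 2 / (2 * z)) * Real.exp (-t) := by
  have h1 : Real.cosh (ν * t) ≤ Real.exp (|ν| * t) := by
    rw [← Real.cosh_abs, abs_mul, abs_of_nonneg ht, Real.cosh_eq]
    have : Real.exp (-(|ν| * t)) ≤ Real.exp (|ν| * t) := by
      apply Real.exp_le_exp.2
      have : 0 ≤ |ν| * t := by positivity
      linarith
    linarith
  have h2 : 1 + t ^ 2 / 2 ≤ Real.cosh t := by
    have h := Real.cosh_sq (t / 2)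
    have h3 : t / 2 ≤ Real.sinh (t / 2) := Real.self_le_sinh_iff.2 (by linarith)
    have h4 := Real.cosh_two_mul (t / 2)
    rw [show 2 * (t / 2) = t by ring] at h4
    nlinarith
  calc _ ≤ Real.exp (-z * Real.cosh t) * Real.exp (|ν| * t) := by gcongr
    _ = Real.exp (-z * Real.cosh t + |ν| * t) := by rw [Real.exp_add]
    _ ≤ Real.exp ((|ν| + 1) ^ 2 / (2 * z) + -t) := by
      apply Real.exp_le_exp.2
      have h3 : (|ν| + 1) ^ 2 / (2 * z) + z * t ^ 2 / 2 - (|ν| + 1) * t =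
          ((|ν| + 1) - z * t) ^ 2 / (2 * z) := by field_simp; ring
      have h4 : 0 ≤ ((|ν| + 1) - z * t) ^ 2 / (2 * z) := by positivity
      nlinarith
    _ = _ := Real.exp_add _ _

lemma bk_int (ν z : ℝ) (hz : 0 < z) :
    IntegrableOn (fun t => Real.exp (-z * Real.cosh t) * Real.cosh (ν * t)) (Set.Ioi 0) := by
  have h : IntegrableOn (fun t : ℝ => Real.exp ((|ν| + 1) ^ 2 / (2 * z)) * Real.exp (-t))
      (Set.Ioi 0) := (integrableOn_exp_neg_Ioi 0).const_mul _
  refine Integrable.mono' h (by fun_prop) ?_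
  refine (ae_restrict_iff' measurableSet_Ioi).2 (Eventually.of_forall fun t ht => ?_)
  rw [Real.norm_of_nonneg (by positivity)]
  exact bk_bound ν z t hz (le_of_lt ht)

lemma cosh_prod (ν t : ℝ) : Real.cosh t * Real.cosh (ν * t) =
    (Real.cosh ((ν + 1) * t) + Real.cosh ((ν - 1) * t)) / 2 := by
  rw [show (ν + 1) * t = ν * t + t by ring, show (ν - 1) * t = ν * t - t by ring,
    Real.cosh_add, Real.cosh_sub]
  ring

lemma bk_cosh_eq (ν z t : ℝ) : Real.exp (-z * Real.cosh t) * (Real.cosh t * Real.cosh (ν * t)) =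
    (1 / 2) * (Real.exp (-z * Real.cosh t) * Real.cosh ((ν + 1) * t)) +
    (1 / 2) * (Real.exp (-z * Real.cosh t) * Real.cosh ((ν - 1) * t)) := by
  rw [cosh_prod]; ring

lemma bk_cosh_int (ν z : ℝ) (hz : 0 < z) :
    IntegrableOn (fun t => Real.exp (-z * Real.cosh t) * (Real.cosh t * Real.cosh (ν * t)))
      (Set.Ioi 0) := by
  simp_rw [bk_cosh_eq]
  exact ((bk_int _ _ hz).const_mul _).add ((bk_int _ _ hz).const_mul _)

lemma bk_cosh (ν z : ℝ) (hz : 0 < z) :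
    ∫ t in Set.Ioi (0:ℝ), Real.exp (-z * Real.cosh t) * (Real.cosh t * Real.cosh (ν * t)) =
      (besselK (ν + 1) z + besselK (ν - 1) z) / 2 := by
  simp_rw [bk_cosh_eq]
  rw [integral_add ((bk_int _ _ hz).const_mul _) ((bk_int _ _ hz).const_mul _),
    integral_const_mul, integral_const_mul]
  unfold besselK
  ring

lemma bk_pos (ν z : ℝ) (hz : 0 < z) : 0 < besselK ν z := by
  unfold besselK
  rw [setIntegral_pos_iff_support_of_nonneg_ae]
  · have : (Function.support fun t => Real.exp (-z * Real.cosh t) * Real.cosh (ν * t)) =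
        Set.univ := by
      ext t
      simp [(Real.cosh_pos _).ne']
    rw [this]; simp
  · exact Eventually.of_forall fun t => by simp only [Pi.zero_apply]; positivity
  · exact bk_int ν z hz

lemma bk_rec (ν z : ℝ) (hz : 0 < z) :
    z * besselK (ν + 1) z = z * besselK (ν - 1) z + 2 * ν * besselK ν z := by
  have e : ∀ t, Real.exp (-z * Real.cosh t) * (-z * Real.sinh t) * Real.sinh (ν * t) +
      Real.exp (-z * Real.cosh t) * (Real.cosh (ν * t) * ν) =
      (-(z / 2)) * (Real.exp (-z * Real.cosh t) * Real.cosh ((ν + 1) * t)) +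
      ((z / 2) * (Real.exp (-z * Real.cosh t) * Real.cosh ((ν - 1) * t)) +
      ν * (Real.exp (-z * Real.cosh t) * Real.cosh (ν * t))) := by
    intro t
    rw [show (ν + 1) * t = ν * t + t by ring, show (ν - 1) * t = ν * t - t by ring,
      Real.cosh_add, Real.cosh_sub]
    ring
  have I1 := (bk_int (ν + 1) z hz).const_mul (-(z / 2))
  have I2 := (bk_int (ν - 1) z hz).const_mul (z / 2)
  have I3 := (bk_int ν z hz).const_mul ν
  have h := integral_Ioi_of_hasDerivAt_of_tendsto' (a := (0:ℝ)) (m := 0)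
    (f := fun t => Real.exp (-z * Real.cosh t) * Real.sinh (ν * t))
    (f' := fun t => Real.exp (-z * Real.cosh t) * (-z * Real.sinh t) * Real.sinh (ν * t) +
      Real.exp (-z * Real.cosh t) * (Real.cosh (ν * t) * ν)) ?_ ?_ ?_
  · simp_rw [e] at h
    rw [integral_add I1 (iadd I2 I3), integral_add I2 I3, integral_const_mul, integral_const_mul,
      integral_const_mul] at h
    simp only [mul_zero, Real.sinh_zero, sub_zero] at h
    unfold besselK
    linarith
  · intro t _
    have h1 : HasDerivAt (fun t => Real.exp (-z * Real.cosh t))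
      (Real.exp (-z * Real.cosh t) * (-z * Real.sinh t)) t :=
      ((Real.hasDerivAt_cosh t).const_mul (-z)).exp
    have h2 : HasDerivAt (fun t => Real.sinh (ν * t)) (Real.cosh (ν * t) * ν) t := by
      simpa using ((hasDerivAt_id t).const_mul ν).sinh
    exact h1.mul h2
  · simp_rw [e]
    exact I1.add (I2.add I3)
  · have hb : Tendsto (fun t : ℝ => Real.exp ((|ν| + 1) ^ 2 / (2 * z)) * Real.exp (-t))
        atTop (nhds 0) := by
      simpa using Real.tendsto_exp_neg_atTop_nhds_zero.const_mul
        (Real.exp ((|ν| + 1) ^ 2 / (2 * z)))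
    refine squeeze_zero_norm' ?_ hb
    filter_upwards [eventually_ge_atTop 0] with t ht
    refine le_trans ?_ (bk_bound ν z t hz ht)
    rw [norm_mul, Real.norm_of_nonneg (Real.exp_pos _).le]
    gcongr
    rw [Real.norm_eq_abs]
    refine abs_le_of_sq_le_sq ?_ (Real.cosh_pos _).le
    have := Real.cosh_sq (ν * t)
    linarith

lemma bk_deriv (ν z : ℝ) (hz : 0 < z) :
    HasDerivAt (besselK ν) (-((besselK (ν + 1) z + besselK (ν - 1) z) / 2)) z := by
  rw [← bk_cosh ν z hz, ← integral_neg]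
  have h := hasDerivAt_integral_of_dominated_loc_of_deriv_le
    (μ := volume.restrict (Set.Ioi (0:ℝ))) (x₀ := z) (s := Set.Ioi (z / 2))
    (F := fun z t => Real.exp (-z * Real.cosh t) * Real.cosh (ν * t))
    (F' := fun z t => -(Real.exp (-z * Real.cosh t) * (Real.cosh t * Real.cosh (ν * t))))
    (bound := fun t => Real.exp (-(z / 2) * Real.cosh t) * (Real.cosh t * Real.cosh (ν * t)))
    (Ioi_mem_nhds (by linarith))
    (Eventually.of_forall fun x => by fun_prop)
    (bk_int ν z hz) (by fun_prop) ?_ (bk_cosh_int ν (z / 2) (by linarith)) ?_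
  · exact h.2
  · refine Eventually.of_forall fun t x hx => ?_
    rw [norm_neg, Real.norm_of_nonneg (by positivity)]
    have : z / 2 < x := hx
    gcongr
  · refine Eventually.of_forall fun t x hx => ?_
    have h1 : HasDerivAt (fun x => Real.exp (-x * Real.cosh t))
      (Real.exp (-x * Real.cosh t) * (-1 * Real.cosh t)) x :=
      ((hasDerivAt_id x).neg.mul_const _).exp
    refine (h1.mul_const (Real.cosh (ν * t))).congr_deriv ?_
    ring

lemma bk_turan (ν z : ℝ) (hz : 0 < z) :
    besselK (ν - 1) z ^ 2 ≤ besselK ν z * besselK (ν - 2) z := by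
  have key : ∀ l : ℝ, 0 ≤ besselK ν z * (l * l) + (2 * besselK (ν - 1) z) * l +
      besselK (ν - 2) z := by
    intro l
    have I1 := (bk_int ν z hz).const_mul (l * l)
    have I2 := (bk_int (ν - 1) z hz).const_mul (2 * l)
    have I3 := bk_int (ν - 2) z hz
    have h : 0 ≤ ∫ t in Set.Ioi (0:ℝ),
        ((l * l) * (Real.exp (-z * Real.cosh t) * Real.cosh (ν * t)) +
        ((2 * l) * (Real.exp (-z * Real.cosh t) * Real.cosh ((ν - 1) * t)) +
        (Real.exp (-z * Real.cosh t) * Real.cosh ((ν - 2) * t)))) := by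
      apply integral_nonneg
      intro t
      simp only [Pi.zero_apply]
      have e : (l * l) * Real.cosh (ν * t) + (2 * l) * Real.cosh ((ν - 1) * t) +
          Real.cosh ((ν - 2) * t) = (Real.exp ((ν - 2) * t) * (l * Real.exp t + 1) ^ 2 +
            Real.exp (-((ν - 2) * t)) * (l * Real.exp (-t) + 1) ^ 2) / 2 := by
        rw [Real.cosh_eq, Real.cosh_eq, Real.cosh_eq,
          show ν * t = (ν - 2) * t + t + t by ring, show (ν - 1) * t = (ν - 2) * t + t by ring,
          neg_add, neg_add, Real.exp_add, Real.exp_add, Real.exp_add, Real.exp_add]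
        ring
      have e2 : 0 ≤ Real.exp (-z * Real.cosh t) * ((l * l) * Real.cosh (ν * t) +
          (2 * l) * Real.cosh ((ν - 1) * t) + Real.cosh ((ν - 2) * t)) := by
        rw [e]; positivity
      linarith
    rw [integral_add I1 (iadd I2 I3), integral_add I2 I3, integral_const_mul,
      integral_const_mul] at h
    unfold besselK
    linarith
  have := discrim_le_zero key
  unfold discrim at this
  linarith

lemma cosh_ratio (ν t u : ℝ) (hν : 1 < ν) (hu : 0 ≤ u) (h : u ≤ t) :
    Real.cosh ((ν - 1) * t) * Real.cosh (ν * u) ≤ Real.cosh ((ν - 1) * u) * Real.cosh (ν * t) := by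
  have h1 : Real.cosh ((ν - 1) * t + ν * u) ≤ Real.cosh (ν * t + (ν - 1) * u) := by
    rw [Real.cosh_le_cosh]
    apply abs_le_abs <;> nlinarith
  have h2 : Real.cosh ((ν - 1) * t - ν * u) ≤ Real.cosh (ν * t - (ν - 1) * u) := by
    rw [Real.cosh_le_cosh]
    apply abs_le_abs <;> nlinarith
  rw [Real.cosh_add, Real.cosh_add] at h1
  rw [Real.cosh_sub, Real.cosh_sub] at h2
  linarith

lemma bk_cheb (ν z : ℝ) (hν : 1 < ν) (hz : 0 < z) :
    besselK ν z * (besselK ν z + besselK (ν - 2) z) ≤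
      besselK (ν - 1) z * (besselK (ν + 1) z + besselK (ν - 1) z) := by
  have hA := bk_pos ν z hz
  have hC := bk_cosh ν z hz
  have hD := bk_cosh (ν - 1) z hz
  rw [show ν - 1 + 1 = ν by ring, show ν - 1 - 1 = ν - 2 by ring] at hD
  have I0 := bk_int ν z hz
  have I1 := bk_int (ν - 1) z hz
  have I2 := bk_cosh_int ν z hz
  have I3 := bk_cosh_int (ν - 1) z hz
  set c := ((besselK (ν + 1) z + besselK (ν - 1) z) / 2) / besselK ν z with hc
  have hc1 : 1 ≤ c := by
    rw [hc, le_div_iff₀ hA, one_mul, ← hC]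
    apply integral_mono I0 I2
    intro t
    have := Real.one_le_cosh t
    have := Real.cosh_pos (ν * t)
    simp only
    gcongr
    nlinarith
  obtain ⟨u, hu, huc⟩ : ∃ u, 0 ≤ u ∧ Real.cosh u = c :=
    ⟨Real.arcosh c, Real.arcosh_nonneg hc1, Real.cosh_arcosh hc1⟩
  set h0 := Real.cosh ((ν - 1) * u) / Real.cosh (ν * u) with hh0
  have h : ∫ t in Set.Ioi (0:ℝ),
      ((Real.exp (-z * Real.cosh t) * (Real.cosh t * Real.cosh ((ν - 1) * t))) +
      ((-h0) * (Real.exp (-z * Real.cosh t) * (Real.cosh t * Real.cosh (ν * t))) +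
      ((-c) * (Real.exp (-z * Real.cosh t) * Real.cosh ((ν - 1) * t)) +
      (c * h0) * (Real.exp (-z * Real.cosh t) * Real.cosh (ν * t))))) ≤ 0 := by
    apply setIntegral_nonpos measurableSet_Ioi
    intro t ht
    have ht : 0 < t := ht
    have hp := Real.cosh_pos (ν * u)
    have key : (Real.cosh t - c) * (Real.cosh ((ν - 1) * t) - h0 * Real.cosh (ν * t)) ≤ 0 := by
      rcases le_total u t with hut | hut
      · apply mul_nonpos_of_nonneg_of_nonpos
        · rw [← huc, sub_nonneg, Real.cosh_le_cosh]
          exact abs_le_abs hut (by linarith)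
        · rw [sub_nonpos, hh0, div_mul_eq_mul_div, le_div_iff₀ hp]
          exact cosh_ratio ν t u hν hu hut
      · apply mul_nonpos_of_nonpos_of_nonneg
        · rw [← huc, sub_nonpos, Real.cosh_le_cosh]
          exact abs_le_abs hut (by linarith)
        · rw [sub_nonneg, hh0, div_mul_eq_mul_div, div_le_iff₀ hp]
          exact cosh_ratio ν u t hν ht.le hut
    have := mul_nonpos_of_nonneg_of_nonpos (Real.exp_pos (-z * Real.cosh t)).le key
    linarith
  rw [integral_add I3 (iadd (I2.const_mul _) (iadd (I1.const_mul _) (I0.const_mul _))),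
    integral_add (I2.const_mul _) (iadd (I1.const_mul _) (I0.const_mul _)),
    integral_add (I1.const_mul _) (I0.const_mul _), integral_const_mul, integral_const_mul,
    integral_const_mul, hC, hD] at h
  change _ + (_ + (-c * besselK (ν - 1) z + c * h0 * besselK ν z)) ≤ 0 at h
  have hcA : c * besselK ν z = (besselK (ν + 1) z + besselK (ν - 1) z) / 2 := by
    rw [hc]; field_simp
  have h5 : (besselK ν z + besselK (ν - 2) z) / 2 ≤ c * besselK (ν - 1) z := by
    rw [← hcA] at h
    linarith
  have h6 := mul_le_mul_of_nonneg_left h5 hA.le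
  have h7 : besselK ν z * (c * besselK (ν - 1) z) =
      (besselK (ν + 1) z + besselK (ν - 1) z) / 2 * besselK (ν - 1) z := by
    rw [← hcA]; ring
  rw [h7] at h6
  linarith

lemma F_deriv (ν z : ℝ) (hz : 0 < z) :
    HasDerivAt (fun z => z ^ ν * besselK ν z) (-(z ^ ν * besselK (ν - 1) z)) z := by
  have h := (Real.hasDerivAt_rpow_const (p := ν) (Or.inl hz.ne')).mul (bk_deriv ν z hz)
  refine h.congr_deriv ?_
  have hr := bk_rec ν z hz
  rw [Real.rpow_sub_one hz.ne']
  have : besselK (ν + 1) z = besselK (ν - 1) z + 2 * ν * besselK ν z / z := by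
    field_simp; linarith
  rw [this]
  field_simp
  ring

lemma G_deriv (ν q z : ℝ) (hz : 0 < z) :
    HasDerivAt (fun z => Real.exp (q * z) * (z ^ ν * besselK ν z))
      (Real.exp (q * z) * z ^ ν * (q * besselK ν z - besselK (ν - 1) z)) z := by
  have h1 : HasDerivAt (fun z => Real.exp (q * z)) (Real.exp (q * z) * q) z := by
    simpa using ((hasDerivAt_id z).const_mul q).exp
  refine (h1.mul (F_deriv ν z hz)).congr_deriv ?_
  ring

lemma main_bound (ν q z : ℝ) (hν : 1 < ν) (hq : 0 < q) (hq1 : q < 1) (hz : 0 < z) :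
    Real.exp (q * z) * (z ^ ν * besselK ν z) <
      Real.exp (q * ((2 * ν - 1) * q / (1 - q ^ 2))) *
        ((2 * (ν - 1) * q / (1 - q ^ 2)) ^ ν * besselK ν (2 * (ν - 1) * q / (1 - q ^ 2))) := by
  have hd : 0 < 1 - q ^ 2 := by nlinarith
  set z0 := 2 * (ν - 1) * q / (1 - q ^ 2) with hz0
  set z1 := (2 * ν - 1) * q / (1 - q ^ 2) with hz1
  have e0 : z0 * (1 - q ^ 2) = 2 * (ν - 1) * q := by rw [hz0]; field_simp
  have e1 : z1 * (1 - q ^ 2) = (2 * ν - 1) * q := by rw [hz1]; field_simp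
  have h0 : 0 < z0 := by
    have : 0 < ν - 1 := by linarith
    positivity
  have h01 : z0 < z1 := by
    rw [hz0, hz1]; gcongr; linarith
  have hF : StrictAntiOn (fun z => z ^ ν * besselK ν z) (Set.Ioi 0) := by
    apply strictAntiOn_of_deriv_neg (convex_Ioi 0)
    · intro w hw
      exact (F_deriv ν w hw).continuousAt.continuousWithinAt
    · intro w hw
      rw [interior_Ioi] at hw
      have hw : 0 < w := hw
      rw [(F_deriv ν w hw).deriv]
      have := bk_pos (ν - 1) w hw
      have : 0 < w ^ ν * besselK (ν - 1) w := by positivity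
      linarith
  have hFpos : ∀ w, 0 < w → 0 < w ^ ν * besselK ν w := fun w hw => by
    have := bk_pos ν w hw
    positivity
  have hT : ∀ w, 0 < w → w * besselK (ν - 1) w ^ 2 + 2 * (ν - 1) * besselK ν w * besselK (ν - 1) w
      ≤ w * besselK ν w ^ 2 := by
    intro w hw
    have h1 := bk_turan ν w hw
    have h2 := bk_rec (ν - 1) w hw
    rw [show ν - 1 + 1 = ν by ring, show ν - 1 - 1 = ν - 2 by ring] at h2
    have h3 := mul_le_mul_of_nonneg_left h1 hw.le
    have h4 : besselK ν w * (w * besselK ν w) = besselK ν w * (w * besselK (ν - 2) w +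
      2 * (ν - 1) * besselK (ν - 1) w) := by rw [h2]
    linarith
  have hC : ∀ w, 0 < w → w * besselK ν w ^ 2 ≤
      w * besselK (ν - 1) w ^ 2 + (2 * ν - 1) * besselK ν w * besselK (ν - 1) w := by
    intro w hw
    have h1 := bk_cheb ν w hν hw
    have h2 := bk_rec (ν - 1) w hw
    have h5 := bk_rec ν w hw
    rw [show ν - 1 + 1 = ν by ring, show ν - 1 - 1 = ν - 2 by ring] at h2
    have h3 := mul_le_mul_of_nonneg_left h1 hw.le
    have h4 : besselK ν w * (w * besselK ν w) = besselK ν w * (w * besselK (ν - 2) w +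
      2 * (ν - 1) * besselK (ν - 1) w) := by rw [h2]
    have h6 : besselK (ν - 1) w * (w * besselK (ν + 1) w) = besselK (ν - 1) w *
      (w * besselK (ν - 1) w + 2 * ν * besselK ν w) := by rw [h5]
    linarith
  rcases le_or_gt z z0 with hzz | hzz
  · have hG : MonotoneOn (fun z => Real.exp (q * z) * (z ^ ν * besselK ν z)) (Set.Ioc 0 z0) := by
      apply monotoneOn_of_deriv_nonneg (convex_Ioc 0 z0)
      · intro w hw
        exact (G_deriv ν q w hw.1).continuousAt.continuousWithinAt
      · intro w hw
        rw [interior_Ioc] at hw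
        exact (G_deriv ν q w hw.1).differentiableAt.differentiableWithinAt
      · intro w hw
        rw [interior_Ioc] at hw
        obtain ⟨hw, hw2⟩ := hw
        rw [(G_deriv ν q w hw).deriv]
        have hA := bk_pos ν w hw
        have hB := bk_pos (ν - 1) w hw
        apply mul_nonneg (by positivity)
        by_contra hneg
        push Not at hneg
        have hlt : q * besselK ν w < besselK (ν - 1) w := by linarith
        have ht := hT w hw
        have a1 : w * (q * besselK ν w) ^ 2 < w * besselK (ν - 1) w ^ 2 := by gcongr
        have a2 : 2 * (ν - 1) * besselK ν w * (q * besselK ν w) <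
            2 * (ν - 1) * besselK ν w * besselK (ν - 1) w := by
          have : 0 < ν - 1 := by linarith
          gcongr
        have a3 : w * (1 - q ^ 2) < 2 * (ν - 1) * q := by rw [← e0]; gcongr
        nlinarith [mul_lt_mul_of_pos_left a3 (pow_pos hA 2)]
    have := hG ⟨hz, hzz⟩ ⟨h0, le_rfl⟩ hzz
    refine lt_of_le_of_lt this ?_
    have := hFpos z0 h0
    simp only
    gcongr
  · have hFz := hF h0 hz hzz
    simp only at hFz
    rcases le_or_gt z z1 with hz1' | hz1'
    · have := hFpos z hz
      calc _ ≤ Real.exp (q * z1) * (z ^ ν * besselK ν z) := by gcongr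
        _ < _ := by gcongr
    · have hG : AntitoneOn (fun z => Real.exp (q * z) * (z ^ ν * besselK ν z)) (Set.Ici z1) := by
        apply antitoneOn_of_deriv_nonpos (convex_Ici z1)
        · intro w hw
          have hw : z1 ≤ w := hw
          exact (G_deriv ν q w (by linarith)).continuousAt.continuousWithinAt
        · intro w hw
          rw [interior_Ici] at hw
          have hw : z1 < w := hw
          exact (G_deriv ν q w (by linarith)).differentiableAt.differentiableWithinAt
        · intro w hw1
          rw [interior_Ici] at hw1
          have hw1 : z1 < w := hw1
          have hw : 0 < w := by linarith
          rw [(G_deriv ν q w hw).deriv]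
          have hA := bk_pos ν w hw
          have hB := bk_pos (ν - 1) w hw
          apply mul_nonpos_of_nonneg_of_nonpos (by positivity)
          by_contra hneg
          push Not at hneg
          have hlt : besselK (ν - 1) w < q * besselK ν w := by linarith
          have ht := hC w hw
          have a1 : w * besselK (ν - 1) w ^ 2 < w * (q * besselK ν w) ^ 2 := by gcongr
          have a2 : (2 * ν - 1) * besselK ν w * besselK (ν - 1) w <
              (2 * ν - 1) * besselK ν w * (q * besselK ν w) := by
            have : 0 < 2 * ν - 1 := by linarith
            gcongr
          have a3 : (2 * ν - 1) * q < w * (1 - q ^ 2) := by rw [← e1]; gcongr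
          nlinarith [mul_lt_mul_of_pos_left a3 (pow_pos hA 2)]
      have h1 := hG (Set.mem_Ici.2 le_rfl) (Set.mem_Ici.2 hz1'.le) hz1'.le
      refine lt_of_le_of_lt h1 ?_
      have := hF h0 (h0.trans h01) h01
      simp only at this ⊢
      gcongr

theorem vg_density_bound_improved (r θ σ μ : ℝ) (hr : 3 < r) (hθ : θ ≠ 0) (hσ : 0 < σ) :
    ∀ x : ℝ, x ≠ μ →
      vgDensity r θ σ μ x <
        (σ * Real.sqrt Real.pi * Real.Gamma (r / 2))⁻¹ * Real.exp (θ ^ 2 * (r - 2) / σ ^ 2) *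
          (|θ| * (r - 3) / (2 * Real.sqrt (θ ^ 2 + σ ^ 2))) ^ ((r - 1) / 2) *
          besselK ((r - 1) / 2) (|θ| * Real.sqrt (θ ^ 2 + σ ^ 2) * (r - 3) / σ ^ 2) := by
  intro x hx
  unfold vgDensity
  have hy : 0 < |x - μ| := abs_pos.2 (sub_ne_zero.2 hx)
  have hT : 0 < |θ| := abs_pos.2 hθ
  have hle : θ * (x - μ) ≤ |θ| * |x - μ| := by rw [← abs_mul]; exact le_abs_self _
  have hT2 : θ ^ 2 = |θ| ^ 2 := (sq_abs θ).symm
  rw [hT2]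
  generalize |x - μ| = y at *
  generalize |θ| = a at *
  have hs : 0 < Real.sqrt (a ^ 2 + σ ^ 2) := by positivity
  have hs2 : Real.sqrt (a ^ 2 + σ ^ 2) ^ 2 = a ^ 2 + σ ^ 2 := Real.sq_sqrt (by positivity)
  generalize Real.sqrt (a ^ 2 + σ ^ 2) = s at *
  have hG : 0 < Real.Gamma (r / 2) := Real.Gamma_pos_of_pos (by linarith)
  have hq1 : a / s < 1 := by
    rw [div_lt_one hs]
    nlinarith [pow_pos hσ 2]
  have hz : 0 < s * y / σ ^ 2 := by positivity
  have h := main_bound ((r - 1) / 2) (a / s) (s * y / σ ^ 2) (by linarith) (by positivity) hq1 hz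
  have hK := bk_pos ((r - 1) / 2) _ hz
  have hr3 : 0 < r - 3 := by linarith
  have d : 1 - (a / s) ^ 2 = σ ^ 2 / s ^ 2 := by
    field_simp; linarith
  have z0e : 2 * ((r - 1) / 2 - 1) * (a / s) / (1 - (a / s) ^ 2) = a * s * (r - 3) / σ ^ 2 := by
    rw [d]; field_simp; ring
  have z1e : a / s * ((2 * ((r - 1) / 2) - 1) * (a / s) / (1 - (a / s) ^ 2)) =
      a ^ 2 * (r - 2) / σ ^ 2 := by
    rw [d]; field_simp; ring
  have z2e : a / s * (s * y / σ ^ 2) = a * y / σ ^ 2 := by field_simp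
  rw [z0e, z1e, z2e] at h
  have p1 : (y / (2 * s)) ^ ((r - 1) / 2) =
      (σ ^ 2 / (2 * s ^ 2)) ^ ((r - 1) / 2) * (s * y / σ ^ 2) ^ ((r - 1) / 2) := by
    rw [← Real.mul_rpow (by positivity) (by positivity)]
    congr 1; field_simp
  have p2 : (a * (r - 3) / (2 * s)) ^ ((r - 1) / 2) =
      (σ ^ 2 / (2 * s ^ 2)) ^ ((r - 1) / 2) * (a * s * (r - 3) / σ ^ 2) ^ ((r - 1) / 2) := by
    rw [← Real.mul_rpow (by positivity) (by positivity)]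
    congr 1; field_simp
  rw [p1, p2]
  have hC : 0 < (σ * Real.sqrt Real.pi * Real.Gamma (r / 2))⁻¹ := by positivity
  generalize (σ * Real.sqrt Real.pi * Real.Gamma (r / 2))⁻¹ = C at *
  have hD : 0 < (σ ^ 2 / (2 * s ^ 2)) ^ ((r - 1) / 2) := by positivity
  generalize (σ ^ 2 / (2 * s ^ 2)) ^ ((r - 1) / 2) = D at *
  have hexp : Real.exp (θ * (x - μ) / σ ^ 2) ≤ Real.exp (a * y / σ ^ 2) := by gcongr
  calc _ = C * D * (Real.exp (θ * (x - μ) / σ ^ 2) *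
        ((s * y / σ ^ 2) ^ ((r - 1) / 2) * besselK ((r - 1) / 2) (s * y / σ ^ 2))) := by ring
    _ ≤ C * D * (Real.exp (a * y / σ ^ 2) *
        ((s * y / σ ^ 2) ^ ((r - 1) / 2) * besselK ((r - 1) / 2) (s * y / σ ^ 2))) := by gcongr
    _ < _ := mul_lt_mul_of_pos_left h (by positivity)
    _ = _ := by ring
end

section
/- Let r > 1, θ ∈ ℝ, σ > 0, μ ∈ ℝ. Let Z be a real random variable whose law has density p (the VG(r,θ,σ,μ) density) with respect to Lebesgue measure, and let W be any integrable real random variable. Then d_K(W,Z) ≤ √(2·C·d_W(W,Z)), where C = (Γ((r−1)/2)/(2σ√π·Γ(r/2)))·(σ²/(θ²+σ²))^{(r−1)/2}·exp(θ²·max(r−2,0)/σ²). -/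
open MeasureTheory Real Filter

/-! ### The auxiliary integral `vgM p c = ∫ exp (p t - e^t - c e^{-t}) dt` -/

/-- Exponential form of the integral `∫ u^{p-1} exp(-u - c/u) du`. -/
noncomputable def vgM (p c : ℝ) : ℝ :=
  ∫ t : ℝ, Real.exp (p * t - Real.exp t - c * Real.exp (-t))

lemma vg_gamma_integrable {p b : ℝ} (hp : 0 < p) (hb : 0 < b) :
    Integrable (fun t : ℝ => Real.exp (p * t - b * Real.exp t)) := by
  have h := integrableOn_rpow_mul_exp_neg_mul_rpow (p := 1) (s := p - 1) (b := b)
    (by linarith) one_pos hb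
  have himg : Real.exp '' Set.univ = Set.Ioi 0 := by
    rw [Set.image_univ, Real.range_exp]
  rw [← himg, integrableOn_image_iff_integrableOn_abs_deriv_smul MeasurableSet.univ
    (fun x _ => (Real.hasDerivAt_exp x).hasDerivWithinAt) Real.exp_injective.injOn,
    integrableOn_univ] at h
  refine h.congr (Eventually.of_forall fun t => ?_)
  simp only [smul_eq_mul, rpow_one, abs_of_pos (Real.exp_pos t)]
  rw [← Real.exp_mul, ← Real.exp_add, ← Real.exp_add]
  congr 1; ring

lemma vg_gamma_eq {p : ℝ} (hp : 0 < p) :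
    ∫ t : ℝ, Real.exp (p * t - Real.exp t) = Real.Gamma p := by
  rw [Real.Gamma_eq_integral hp]
  have himg : Real.exp '' Set.univ = Set.Ioi 0 := by
    rw [Set.image_univ, Real.range_exp]
  rw [← himg, integral_image_eq_integral_abs_deriv_smul MeasurableSet.univ
    (fun x _ => (Real.hasDerivAt_exp x).hasDerivWithinAt) Real.exp_injective.injOn,
    setIntegral_univ]
  congr 1; ext t
  simp only [smul_eq_mul, abs_of_pos (Real.exp_pos t)]
  rw [← Real.exp_mul, ← Real.exp_add, ← Real.exp_add]
  congr 1; ring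

lemma vgM_integrable (p : ℝ) {c : ℝ} (hc : 0 < c) :
    Integrable (fun t : ℝ => Real.exp (p * t - Real.exp t - c * Real.exp (-t))) := by
  obtain ⟨n, hn⟩ := exists_nat_gt (-p)
  have h := (vg_gamma_integrable (p := p + n) (b := 1) (by linarith) one_pos).const_mul
    ((n.factorial : ℝ) / c ^ n)
  refine h.mono' (by fun_prop) (Eventually.of_forall fun t => ?_)
  rw [Real.norm_eq_abs, abs_of_pos (Real.exp_pos _)]
  have h1 := Real.pow_div_factorial_le_exp (c * Real.exp (-t)) (by positivity) n
  have hf : (0 : ℝ) < n.factorial := by positivity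
  have h2 : Real.exp (-(c * Real.exp (-t))) ≤ n.factorial / c ^ n * Real.exp (n * t) := by
    rw [Real.exp_neg]
    rw [div_le_iff₀ hf] at h1
    have h3 : (Real.exp (-t)) ^ n * Real.exp (n * t) = 1 := by
      rw [← Real.exp_nat_mul, ← Real.exp_add]; simp
    rw [inv_le_iff_one_le_mul₀ (Real.exp_pos _)]
    have h4 : 1 = (c * Real.exp (-t)) ^ n / c ^ n * Real.exp (n * t) := by
      rw [mul_pow, mul_div_cancel_left₀ _ (by positivity), h3]
    rw [h4]
    calc _ ≤ (Real.exp (c * Real.exp (-t)) * n.factorial) / c ^ n * Real.exp (n * t) := by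
          gcongr
      _ = _ := by ring
  calc Real.exp (p * t - Real.exp t - c * Real.exp (-t))
      = Real.exp (p * t - Real.exp t) * Real.exp (-(c * Real.exp (-t))) := by
        rw [← Real.exp_add]; congr 1
    _ ≤ Real.exp (p * t - Real.exp t) * (n.factorial / c ^ n * Real.exp (n * t)) := by gcongr
    _ = n.factorial / c ^ n * Real.exp ((p + n) * t - 1 * Real.exp t) := by
        have : Real.exp ((p + n) * t - 1 * Real.exp t)
          = Real.exp (p * t - Real.exp t) * Real.exp (n * t) := by
          rw [← Real.exp_add]; congr 1; ring
        rw [this]; ring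

lemma vgM_nonneg (p c : ℝ) : 0 ≤ vgM p c := integral_nonneg fun _ => (Real.exp_pos _).le

lemma vgM_pos (p : ℝ) {c : ℝ} (hc : 0 < c) : 0 < vgM p c := integral_exp_pos (vgM_integrable p hc)

lemma vgM_le_gamma {p c : ℝ} (hp : 0 < p) (hc : 0 < c) : vgM p c ≤ Real.Gamma p := by
  rw [← vg_gamma_eq hp]
  refine integral_mono (vgM_integrable p hc)
    (by simpa using vg_gamma_integrable hp one_pos) fun t => ?_
  apply Real.exp_le_exp.2
  have : 0 < c * Real.exp (-t) := by positivity
  linarith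

/-- exponential decay -/
lemma vgM_decay {p s : ℝ} (hp : 0 < p) (hs0 : 0 ≤ s) (hs : s < 1) :
    ∃ D : ℝ, 0 ≤ D ∧ ∀ y : ℝ, 0 < y → vgM p (y ^ 2 / 4) ≤ D * Real.exp (-(s * y)) := by
  have hb : 0 < 1 - s ^ 2 := by nlinarith
  refine ⟨∫ t : ℝ, Real.exp (p * t - (1 - s ^ 2) * Real.exp t),
    integral_nonneg fun _ => (Real.exp_pos _).le, fun y hy => ?_⟩
  rw [← integral_mul_const]
  refine integral_mono (vgM_integrable p (by positivity))
    ((vg_gamma_integrable hp hb).mul_const _) fun t => ?_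
  dsimp only
  rw [← Real.exp_add]
  apply Real.exp_le_exp.2
  have h : Real.exp (-t) * Real.exp t = 1 := by rw [← Real.exp_add]; simp
  have h1 : 0 ≤ Real.exp (-t) * (s * Real.exp t - y / 2) ^ 2 := by positivity
  have h2 : Real.exp (-t) * (s * Real.exp t - y / 2) ^ 2
    = s ^ 2 * Real.exp t - s * y + y ^ 2 / 4 * Real.exp (-t) := by
    linear_combination (s ^ 2 * Real.exp t - s * y) * h
  linarith

lemma vgM_rec (p : ℝ) {c : ℝ} (hc : 0 < c) :
    vgM (p + 1) c = p * vgM p c + c * vgM (p - 1) c := by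
  have h0 := vgM_integrable p hc
  have h1 := vgM_integrable (p + 1) hc
  have h2 := vgM_integrable (p - 1) hc
  have hi := ((h0.const_mul p).sub h1).add (h2.const_mul c)
  have h := integral_eq_zero_of_hasDerivAt_of_integrable
    (f := fun t : ℝ => Real.exp (p * t - Real.exp t - c * Real.exp (-t)))
    (f' := fun t : ℝ => p * Real.exp (p * t - Real.exp t - c * Real.exp (-t))
      - Real.exp ((p + 1) * t - Real.exp t - c * Real.exp (-t))
      + c * Real.exp ((p - 1) * t - Real.exp t - c * Real.exp (-t))) ?_ hi h0
  · have e1 := integral_add (((h0.const_mul p).sub h1)) (h2.const_mul c)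
    have e2 := integral_sub (h0.const_mul p) h1
    simp only [Pi.sub_apply, integral_const_mul] at e1 e2
    rw [e1, e2] at h
    unfold vgM
    linarith
  · intro t
    have hd : HasDerivAt (fun t : ℝ => p * t - Real.exp t - c * Real.exp (-t))
        (p * 1 - Real.exp t - c * (Real.exp (-t) * (-1))) t :=
      (((hasDerivAt_id t).const_mul p).sub (Real.hasDerivAt_exp t)).sub
        (((hasDerivAt_neg t).exp).const_mul c)
    refine hd.exp.congr_deriv ?_
    have e1 : Real.exp ((p + 1) * t - Real.exp t - c * Real.exp (-t))
      = Real.exp (p * t - Real.exp t - c * Real.exp (-t)) * Real.exp t := by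
      rw [← Real.exp_add]; congr 1; ring
    have e2 : Real.exp ((p - 1) * t - Real.exp t - c * Real.exp (-t))
      = Real.exp (p * t - Real.exp t - c * Real.exp (-t)) * Real.exp (-t) := by
      rw [← Real.exp_add]; congr 1; ring
    rw [e1, e2]; ring

lemma vgM_hasDerivAt (p : ℝ) {c : ℝ} (hc : 0 < c) :
    HasDerivAt (vgM p) (-vgM (p - 1) c) c := by
  have h := hasDerivAt_integral_of_dominated_loc_of_deriv_le (μ := volume) (𝕜 := ℝ)
    (F := fun c t : ℝ => Real.exp (p * t - Real.exp t - c * Real.exp (-t)))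
    (F' := fun c t : ℝ => - Real.exp ((p - 1) * t - Real.exp t - c * Real.exp (-t)))
    (bound := fun t : ℝ => Real.exp ((p - 1) * t - Real.exp t - (c / 2) * Real.exp (-t)))
    (s := Set.Ioi (c / 2)) (x₀ := c) (Ioi_mem_nhds (by linarith))
    (Eventually.of_forall fun x => by fun_prop) (vgM_integrable p hc) (by fun_prop)
    (Eventually.of_forall fun t x hx => ?_) (vgM_integrable (p - 1) (by linarith))
    (Eventually.of_forall fun t x hx => ?_)
  · have := h.2
    rw [integral_neg] at this
    exact this
  · rw [norm_neg, Real.norm_eq_abs, abs_of_pos (Real.exp_pos _)]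
    apply Real.exp_le_exp.2
    have : c / 2 * Real.exp (-t) ≤ x * Real.exp (-t) := by
      gcongr
      exact le_of_lt hx
    linarith
  · have hd : HasDerivAt (fun x : ℝ => p * t - Real.exp t - x * Real.exp (-t))
        (-(1 * Real.exp (-t))) x :=
      ((hasDerivAt_id x).mul_const (Real.exp (-t))).const_sub _
    refine hd.exp.congr_deriv ?_
    have e2 : Real.exp ((p - 1) * t - Real.exp t - x * Real.exp (-t))
      = Real.exp (p * t - Real.exp t - x * Real.exp (-t)) * Real.exp (-t) := by
      rw [← Real.exp_add]; congr 1; ring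
    rw [e2]; ring

lemma vgM_bessel (p : ℝ) {y : ℝ} (hy : 0 < y) :
    vgM p (y ^ 2 / 4) = 2 * (y / 2) ^ p * besselK p y := by
  have hc : 0 < y ^ 2 / 4 := by positivity
  set L := Real.log (y / 2) with hL
  have heL : Real.exp L = y / 2 := Real.exp_log (by positivity)
  have heL' : Real.exp (-L) = 2 / y := by rw [Real.exp_neg, heL]; field_simp
  set g : ℝ → ℝ := fun t => Real.exp (-y * Real.cosh t) * Real.exp (p * t) with hg
  have key : ∀ t : ℝ, Real.exp (p * (t + L) - Real.exp (t + L) - y ^ 2 / 4 * Real.exp (-(t + L)))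
      = (y / 2) ^ p * g t := by
    intro t
    rw [Real.rpow_def_of_pos (by positivity), hg]
    dsimp only
    rw [← Real.exp_add, ← Real.exp_add, Real.cosh_eq, neg_add, Real.exp_add, Real.exp_add, heL,
      heL', ← hL]
    congr 1; field_simp; ring
  have hpow : (0 : ℝ) < (y / 2) ^ p := by positivity
  have hgi : Integrable g := by
    have h := (vgM_integrable p hc).comp_add_right L
    have h2 := h.const_mul ((y / 2) ^ p)⁻¹
    refine h2.congr (Eventually.of_forall fun t => ?_)
    dsimp only
    rw [key t]; field_simp
  have h1 : vgM p (y ^ 2 / 4) = (y / 2) ^ p * ∫ t, g t := by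
    unfold vgM
    rw [← integral_add_right_eq_self _ L, ← integral_const_mul]
    congr 1; ext t; exact key t
  have h2 : ∫ t, g t = 2 * besselK p y := by
    rw [← integral_add_compl (measurableSet_Ioi (a := (0 : ℝ))) hgi, Set.compl_Ioi]
    have h3 : ∫ t in Set.Iic (0 : ℝ), g t = ∫ t in Set.Ioi (0 : ℝ), g (-t) := by
      rw [integral_comp_neg_Ioi]; simp
    rw [h3, ← integral_add hgi.integrableOn hgi.comp_neg.integrableOn, besselK,
      ← integral_const_mul]
    congr 1; ext t
    simp only [hg, Real.cosh_neg]
    rw [Real.cosh_eq (p * t)]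
    rw [mul_neg]; ring
  rw [h1, h2]; ring

/-- The function `y ↦ vgM ν (y²/4)` and its derivative. -/
lemma vg_g_hasDerivAt (ν : ℝ) {y : ℝ} (hy : 0 < y) :
    HasDerivAt (fun y => vgM ν (y ^ 2 / 4)) (-(y / 2) * vgM (ν - 1) (y ^ 2 / 4)) y := by
  have h1 := vgM_hasDerivAt ν (c := y ^ 2 / 4) (by positivity)
  have h2 : HasDerivAt (fun y : ℝ => y ^ 2 / 4) (y / 2) y := by
    refine ((hasDerivAt_pow 2 y).div_const 4).congr_deriv ?_
    norm_num; ring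
  refine (h1.comp y h2).congr_deriv ?_
  ring

lemma vg_no_max {ν s y : ℝ} (hy : 0 < y) (hm : (2 * ν - 1) * s < y * (1 - s ^ 2))
    (hmax : IsLocalMax (fun y => Real.exp (s * y) * vgM ν (y ^ 2 / 4)) y) : False := by
  set F : ℝ → ℝ := fun y => Real.exp (s * y) * vgM ν (y ^ 2 / 4) with hF
  set k : ℝ → ℝ := fun y => s * vgM ν (y ^ 2 / 4) + -(y / 2) * vgM (ν - 1) (y ^ 2 / 4) with hk
  have hexp : ∀ z : ℝ, HasDerivAt (fun y => Real.exp (s * y)) (Real.exp (s * z) * s) z := by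
    intro z
    exact ((hasDerivAt_id z).const_mul s).exp.congr_deriv (by simp)
  have hF1 : ∀ z : ℝ, 0 < z → HasDerivAt F (Real.exp (s * z) * k z) z := by
    intro z hz
    refine ((hexp z).mul (vg_g_hasDerivAt ν hz)).congr_deriv ?_
    simp only [hk]; ring
  have hk0 : k y = 0 := by
    have := hmax.hasDerivAt_eq_zero (hF1 y hy)
    exact (mul_eq_zero.1 this).resolve_left (Real.exp_pos _).ne'
  have hc : 0 < y ^ 2 / 4 := by positivity
  have hrec := vgM_rec (ν - 1) hc
  rw [sub_add_cancel] at hrec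
  have hMpos := vgM_pos ν hc
  set k2 : ℝ := s * (-(y / 2) * vgM (ν - 1) (y ^ 2 / 4)) + (-(1 / 2) * vgM (ν - 1) (y ^ 2 / 4)
    + -(y / 2) * (-(y / 2) * vgM (ν - 1 - 1) (y ^ 2 / 4))) with hk2
  have hkd : HasDerivAt k k2 y := by
    have h1 : HasDerivAt (fun y : ℝ => -(y / 2)) (-(1 / 2)) y :=
      ((hasDerivAt_id y).div_const 2).neg
    exact ((vg_g_hasDerivAt ν hy).const_mul s).add (h1.mul (vg_g_hasDerivAt (ν - 1) hy))
  have hk2pos : 0 < k2 := by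
    have h0 : s * vgM ν (y ^ 2 / 4) = y / 2 * vgM (ν - 1) (y ^ 2 / 4) := by
      simp only [hk] at hk0; linarith
    have e : y * k2 = vgM ν (y ^ 2 / 4) * (y * (1 - s ^ 2) - (2 * ν - 1) * s) := by
      rw [hk2]
      linear_combination (-(s * y) + (-(2 * ν - 1))) * (-1) * h0 - y * hrec
    have : 0 < y * k2 := by
      rw [e]; exact mul_pos hMpos (by linarith)
    exact pos_of_mul_pos_right this hy.le
  have hdd : HasDerivAt (deriv F) (Real.exp (s * y) * k2) y := by
    have h1 : HasDerivAt (fun z => Real.exp (s * z) * k z) (Real.exp (s * y) * k2) y :=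
      ((hexp y).mul hkd).congr_deriv (by rw [hk0]; ring)
    refine h1.congr_of_eventuallyEq ?_
    filter_upwards [lt_mem_nhds hy] with z hz
    exact (hF1 z hz).deriv
  have hmin : IsLocalMin F y := by
    apply isLocalMin_of_deriv_deriv_pos
    · rw [hdd.deriv]; positivity
    · rw [(hF1 y hy).deriv, hk0, mul_zero]
    · exact (hF1 y hy).continuousAt
  have hconst : F =ᶠ[nhds y] fun _ => F y := by
    filter_upwards [hmin, hmax] with z h1 h2
    exact le_antisymm h2 h1
  have hd0 : deriv (deriv F) y = 0 := by
    rw [hconst.deriv.deriv_eq]; simp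
  rw [hdd.deriv] at hd0
  have : 0 < Real.exp (s * y) * k2 := by positivity
  linarith

lemma vg_key_s14 {ν s y : ℝ} (hν : 0 < ν) (hs0 : 0 ≤ s) (hs : s < 1) (hy : 0 < y) :
    Real.exp (s * y) * vgM ν (y ^ 2 / 4)
      ≤ Real.Gamma ν * Real.exp (s ^ 2 / (1 - s ^ 2) * max (2 * ν - 1) 0) := by
  have hb : 0 < 1 - s ^ 2 := by nlinarith
  set F : ℝ → ℝ := fun y => Real.exp (s * y) * vgM ν (y ^ 2 / 4) with hF
  set m : ℝ := s / (1 - s ^ 2) * max (2 * ν - 1) 0 with hm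
  have hm0 : 0 ≤ m := by positivity
  have hG : 0 < Real.Gamma ν := Real.Gamma_pos_of_pos hν
  have hFle : ∀ z Y : ℝ, 0 < z → z ≤ Y → F z ≤ Real.Gamma ν * Real.exp (s * Y) := by
    intro z Y hz hzY
    have h1 := vgM_le_gamma hν (c := z ^ 2 / 4) (by positivity)
    have h2 : Real.exp (s * z) ≤ Real.exp (s * Y) := Real.exp_le_exp.2 (by gcongr)
    simp only [hF]
    rw [mul_comm]
    exact mul_le_mul h1 h2 (Real.exp_pos _).le hG.le
  have hFcont : ContinuousOn F (Set.Ioi 0) := by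
    intro z hz
    have h1 : HasDerivAt (fun y => Real.exp (s * y)) _ z := ((hasDerivAt_id z).const_mul s).exp
    exact (h1.mul (vg_g_hasDerivAt ν hz)).continuousAt.continuousWithinAt
  have hε : ∀ ε : ℝ, 0 < ε → F y ≤ Real.Gamma ν * Real.exp (s * (m + ε)) := by
    intro ε hε
    by_contra! hcon
    set Y := m + ε with hY
    have hYpos : 0 < Y := by positivity
    have hyY : Y < y := by
      by_contra! h
      exact absurd (hFle y Y hy h) (not_le.2 hcon)
    have hFY := hFle Y Y hYpos le_rfl
    have hFy : 0 < F y := lt_of_le_of_lt (by positivity) hcon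
    -- decay
    obtain ⟨D, hD0, hD⟩ := vgM_decay (p := ν) (s := (1 + s) / 2) hν (by linarith) (by linarith)
    obtain ⟨R, hRy, hR⟩ : ∃ R, y < R ∧ F R < F y := by
      have ht : Tendsto (fun z : ℝ => D * Real.exp (-((1 - s) / 2 * z))) atTop (nhds 0) := by
        have h1 : Tendsto (fun z : ℝ => (1 - s) / 2 * z) atTop atTop :=
          tendsto_id.const_mul_atTop (by linarith)
        simpa using (Real.tendsto_exp_neg_atTop_nhds_zero.comp h1).const_mul D
      obtain ⟨R, h1, h2⟩ := ((ht.eventually (gt_mem_nhds hFy)).and (eventually_gt_atTop y)).exists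
      refine ⟨R, h2, lt_of_le_of_lt ?_ h1⟩
      have := hD R (hy.trans h2)
      simp only [hF]
      calc _ ≤ Real.exp (s * R) * (D * Real.exp (-((1 + s) / 2 * R))) := by gcongr
        _ = D * (Real.exp (s * R) * Real.exp (-((1 + s) / 2 * R))) := by ring
        _ = _ := by rw [← Real.exp_add]; congr 2; ring
    obtain ⟨w, hw, hwmax⟩ := isCompact_Icc.exists_isMaxOn (s := Set.Icc Y R) ⟨y, hyY.le, hRy.le⟩
      (hFcont.mono fun z hz => lt_of_lt_of_le hYpos hz.1)
    have hwy : F y ≤ F w := hwmax ⟨hyY.le, hRy.le⟩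
    have hwY : Y < w := lt_of_le_of_ne hw.1 (by rintro h; rw [← h] at hwy; linarith)
    have hwR : w < R := lt_of_le_of_ne hw.2 (by rintro h; rw [h] at hwy; linarith)
    refine vg_no_max (ν := ν) (s := s) (y := w) (by linarith) ?_
      (hwmax.isLocalMax (Icc_mem_nhds hwY hwR))
    have h1 : m * (1 - s ^ 2) = s * max (2 * ν - 1) 0 := by rw [hm]; field_simp
    have h2 : s * (2 * ν - 1) ≤ s * max (2 * ν - 1) 0 := by gcongr; exact le_max_left _ _
    have h3 : m * (1 - s ^ 2) < w * (1 - s ^ 2) := by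
      apply mul_lt_mul_of_pos_right _ hb; linarith
    linarith
  have hlim : Tendsto (fun ε : ℝ => Real.Gamma ν * Real.exp (s * (m + ε)))
      (nhdsWithin 0 (Set.Ioi 0)) (nhds (Real.Gamma ν * Real.exp (s * (m + 0)))) := by
    apply Tendsto.mono_left _ nhdsWithin_le_nhds
    apply Continuous.tendsto (f := fun ε : ℝ => Real.Gamma ν * Real.exp (s * (m + ε)))
    fun_prop
  have := ge_of_tendsto hlim (eventually_nhdsWithin_of_forall fun ε h => hε ε h)
  refine this.trans (le_of_eq ?_)
  rw [hm]; congr 2; ring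

/-- Rewriting of the density. -/
lemma vgDensity_eq (r θ μ x : ℝ) {σ : ℝ} (hσ : 0 < σ) (hx : x ≠ μ) :
    vgDensity r θ σ μ x = (2 * σ * Real.sqrt Real.pi * Real.Gamma (r / 2))⁻¹ *
      (σ ^ 2 / (θ ^ 2 + σ ^ 2)) ^ ((r - 1) / 2) * (Real.exp (θ * (x - μ) / σ ^ 2) *
        vgM ((r - 1) / 2) ((Real.sqrt (θ ^ 2 + σ ^ 2) * |x - μ| / σ ^ 2) ^ 2 / 4)) := by
  have hA2 : 0 < θ ^ 2 + σ ^ 2 := by positivity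
  have hA : 0 < Real.sqrt (θ ^ 2 + σ ^ 2) := Real.sqrt_pos.2 hA2
  have hxx : 0 < |x - μ| := abs_pos.2 (sub_ne_zero.2 hx)
  have hy : 0 < Real.sqrt (θ ^ 2 + σ ^ 2) * |x - μ| / σ ^ 2 := by positivity
  rw [vgM_bessel _ hy, vgDensity]
  have e : (|x - μ| / (2 * Real.sqrt (θ ^ 2 + σ ^ 2))) ^ ((r - 1) / 2)
      = (σ ^ 2 / (θ ^ 2 + σ ^ 2)) ^ ((r - 1) / 2)
        * (Real.sqrt (θ ^ 2 + σ ^ 2) * |x - μ| / σ ^ 2 / 2) ^ ((r - 1) / 2) := by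
    rw [← Real.mul_rpow (by positivity) (by positivity)]
    congr 1
    have := Real.sq_sqrt hA2.le
    have e2 : σ ^ 2 / (θ ^ 2 + σ ^ 2) = σ ^ 2 / (Real.sqrt (θ ^ 2 + σ ^ 2)) ^ 2 := by rw [this]
    rw [e2]
    field_simp
  rw [e]
  have e3 : (2 * σ * Real.sqrt Real.pi * Real.Gamma (r / 2))⁻¹
    = 2⁻¹ * (σ * Real.sqrt Real.pi * Real.Gamma (r / 2))⁻¹ := by
    rw [← mul_inv]; congr 1; ring
  rw [e3]; ring

lemma vg_exp_le (θ μ x : ℝ) {σ : ℝ} (hσ : 0 < σ) :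
    Real.exp (θ * (x - μ) / σ ^ 2) ≤ Real.exp (|θ| / Real.sqrt (θ ^ 2 + σ ^ 2) *
      (Real.sqrt (θ ^ 2 + σ ^ 2) * |x - μ| / σ ^ 2)) := by
  have hA : 0 < Real.sqrt (θ ^ 2 + σ ^ 2) := Real.sqrt_pos.2 (by positivity)
  apply Real.exp_le_exp.2
  have : |θ| / Real.sqrt (θ ^ 2 + σ ^ 2) * (Real.sqrt (θ ^ 2 + σ ^ 2) * |x - μ| / σ ^ 2)
    = |θ * (x - μ)| / σ ^ 2 := by rw [abs_mul]; field_simp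
  rw [this]
  gcongr
  exact le_abs_self _

lemma vg_s_lt (θ : ℝ) {σ : ℝ} (hσ : 0 < σ) : |θ| / Real.sqrt (θ ^ 2 + σ ^ 2) < 1 := by
  have hA : 0 < Real.sqrt (θ ^ 2 + σ ^ 2) := Real.sqrt_pos.2 (by positivity)
  rw [div_lt_one hA]
  apply Real.lt_sqrt_of_sq_lt
  rw [sq_abs]; nlinarith

lemma vgDensity_le {r θ σ μ x : ℝ} (hr : 1 < r) (hσ : 0 < σ) (hx : x ≠ μ) :
    vgDensity r θ σ μ x ≤ Real.Gamma ((r - 1) / 2) /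
          (2 * σ * Real.sqrt Real.pi * Real.Gamma (r / 2)) *
          (σ ^ 2 / (θ ^ 2 + σ ^ 2)) ^ ((r - 1) / 2) *
          Real.exp (θ ^ 2 * max (r - 2) 0 / σ ^ 2) := by
  have hA2 : 0 < θ ^ 2 + σ ^ 2 := by positivity
  have hA : 0 < Real.sqrt (θ ^ 2 + σ ^ 2) := Real.sqrt_pos.2 hA2
  have hxx : 0 < |x - μ| := abs_pos.2 (sub_ne_zero.2 hx)
  have hy : 0 < Real.sqrt (θ ^ 2 + σ ^ 2) * |x - μ| / σ ^ 2 := by positivity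
  have hG : 0 < Real.Gamma (r / 2) := Real.Gamma_pos_of_pos (by linarith)
  have hpi : 0 < Real.sqrt Real.pi := Real.sqrt_pos.2 Real.pi_pos
  rw [vgDensity_eq r θ μ x hσ hx]
  have hkey := vg_key_s14 (ν := (r - 1) / 2) (s := |θ| / Real.sqrt (θ ^ 2 + σ ^ 2)) (by linarith)
    (by positivity) (vg_s_lt θ hσ) hy
  have e1 : (|θ| / Real.sqrt (θ ^ 2 + σ ^ 2)) ^ 2 = θ ^ 2 / (θ ^ 2 + σ ^ 2) := by
    rw [div_pow, sq_abs, Real.sq_sqrt hA2.le]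
  have e2 : θ ^ 2 / (θ ^ 2 + σ ^ 2) / (1 - θ ^ 2 / (θ ^ 2 + σ ^ 2)) * max (r - 2) 0
      = θ ^ 2 * max (r - 2) 0 / σ ^ 2 := by
    have : 1 - θ ^ 2 / (θ ^ 2 + σ ^ 2) = σ ^ 2 / (θ ^ 2 + σ ^ 2) := by field_simp; ring
    rw [this]; field_simp
  rw [e1, show 2 * ((r - 1) / 2) - 1 = r - 2 by ring, e2] at hkey
  have h2 := (mul_le_mul_of_nonneg_right (vg_exp_le θ μ x hσ) (vgM_nonneg ((r - 1) / 2)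
    ((Real.sqrt (θ ^ 2 + σ ^ 2) * |x - μ| / σ ^ 2) ^ 2 / 4))).trans hkey
  refine (mul_le_mul_of_nonneg_left h2 (by positivity)).trans (le_of_eq ?_)
  rw [div_eq_mul_inv (Real.Gamma ((r - 1) / 2))]
  ring

lemma vgDensity_decay (r θ σ μ : ℝ) (hr : 1 < r) (hσ : 0 < σ) :
    ∃ D δ : ℝ, 0 ≤ D ∧ 0 < δ ∧ ∀ x, x ≠ μ →
      vgDensity r θ σ μ x ≤ D * Real.exp (-(δ * |x - μ|)) := by
  have hA2 : 0 < θ ^ 2 + σ ^ 2 := by positivity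
  have hA : 0 < Real.sqrt (θ ^ 2 + σ ^ 2) := Real.sqrt_pos.2 hA2
  have hG : 0 < Real.Gamma (r / 2) := Real.Gamma_pos_of_pos (by linarith)
  have hpi : 0 < Real.sqrt Real.pi := Real.sqrt_pos.2 Real.pi_pos
  have hs := vg_s_lt θ hσ
  set s := |θ| / Real.sqrt (θ ^ 2 + σ ^ 2) with hsdef
  have hs0 : 0 ≤ s := by positivity
  obtain ⟨D, hD0, hD⟩ := vgM_decay (p := (r - 1) / 2) (s := (1 + s) / 2) (by linarith)
    (by linarith) (by linarith)
  refine ⟨(2 * σ * Real.sqrt Real.pi * Real.Gamma (r / 2))⁻¹ *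
      (σ ^ 2 / (θ ^ 2 + σ ^ 2)) ^ ((r - 1) / 2) * D,
      (1 - s) / 2 * (Real.sqrt (θ ^ 2 + σ ^ 2) / σ ^ 2), by positivity,
      mul_pos (by linarith) (by positivity), fun x hx => ?_⟩
  have hxx : 0 < |x - μ| := abs_pos.2 (sub_ne_zero.2 hx)
  have hy : 0 < Real.sqrt (θ ^ 2 + σ ^ 2) * |x - μ| / σ ^ 2 := by positivity
  rw [vgDensity_eq r θ μ x hσ hx, mul_assoc _ D]
  refine mul_le_mul_of_nonneg_left ?_ (by positivity)
  calc _ ≤ Real.exp (s * (Real.sqrt (θ ^ 2 + σ ^ 2) * |x - μ| / σ ^ 2)) *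
        (D * Real.exp (-((1 + s) / 2 * (Real.sqrt (θ ^ 2 + σ ^ 2) * |x - μ| / σ ^ 2)))) :=
        mul_le_mul (vg_exp_le θ μ x hσ) (hD _ hy) (vgM_nonneg _ _) (Real.exp_pos _).le
    _ = D * (Real.exp (s * (Real.sqrt (θ ^ 2 + σ ^ 2) * |x - μ| / σ ^ 2)) *
        Real.exp (-((1 + s) / 2 * (Real.sqrt (θ ^ 2 + σ ^ 2) * |x - μ| / σ ^ 2)))) := by ring
    _ = _ := by rw [← Real.exp_add]; congr 2; ring

lemma vg_integral_bound {n : Measure ℝ} {C : ℝ} (hC : 0 ≤ C)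
    (hn : n ≤ ENNReal.ofReal C • (volume : Measure ℝ)) {f : ℝ → ℝ} (hf : ∀ x, 0 ≤ f x)
    (hfi : Integrable f) : ∫ x, f x ∂n ≤ C * ∫ x, f x := by
  have h := integral_mono_measure hn (Eventually.of_forall hf)
    (hfi.smul_measure ENNReal.ofReal_ne_top)
  rwa [integral_smul_measure, ENNReal.toReal_ofReal hC, smul_eq_mul] at h

lemma vg_kol_aux (m n : Measure ℝ) [IsProbabilityMeasure m] [IsProbabilityMeasure n]
    {C d : ℝ} (hC : 0 ≤ C) (hn : n ≤ ENNReal.ofReal C • (volume : Measure ℝ))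
    (hd : ∀ f : ℝ → ℝ, LipschitzWith 1 f → |(∫ x, f x ∂m) - ∫ x, f x ∂n| ≤ d)
    (z : ℝ) {ε : ℝ} (hε : 0 < ε) :
    |m.real (Set.Iic z) - n.real (Set.Iic z)| ≤ d / ε + C * ε / 2 := by
  set q : ℝ → ℝ → ℝ := fun a x => max 0 (min ε (a + ε - x)) with hq
  have hqlip : ∀ a, LipschitzWith 1 (q a) := by
    intro a
    have h1 : LipschitzWith 1 (fun x : ℝ => a + ε - x) := by
      apply LipschitzWith.of_dist_le_mul
      intro x y
      rw [Real.dist_eq, Real.dist_eq, abs_sub_comm x y]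
      simp
    exact (h1.const_min ε).const_max 0
  have hq0 : ∀ a x, 0 ≤ q a x := fun a x => le_max_left _ _
  have hqε : ∀ a x, q a x ≤ ε := fun a x => max_le hε.le (min_le_left _ _)
  have hqi : ∀ (k : Measure ℝ) [IsProbabilityMeasure k] (a : ℝ), Integrable (q a) k := by
    intro k _ a
    refine Integrable.mono' (integrable_const ε) (hqlip a).continuous.aestronglyMeasurable
      (Eventually.of_forall fun x => ?_)
    rw [Real.norm_eq_abs, abs_of_nonneg (hq0 a x)]
    exact hqε a x
  have hind : ∀ (k : Measure ℝ) [IsProbabilityMeasure k] (a : ℝ),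
      Integrable ((Set.Iic a).indicator fun _ => ε) k := fun k _ a =>
    (integrable_const ε).indicator measurableSet_Iic
  have hindv : ∀ (k : Measure ℝ) [IsProbabilityMeasure k] (a : ℝ),
      ∫ x, (Set.Iic a).indicator (fun _ => ε) x ∂k = ε * k.real (Set.Iic a) := by
    intro k _ a
    rw [integral_indicator_const _ measurableSet_Iic, smul_eq_mul, mul_comm]
  have hlow : ∀ (k : Measure ℝ) [IsProbabilityMeasure k] (a : ℝ),
      ε * k.real (Set.Iic a) ≤ ∫ x, q a x ∂k := by
    intro k _ a
    rw [← hindv]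
    refine integral_mono (hind k a) (hqi k a) fun x => ?_
    by_cases hx : x ≤ a
    · rw [Set.indicator_of_mem (Set.mem_Iic.2 hx)]
      exact le_max_of_le_right (le_min le_rfl (by linarith))
    · rw [Set.indicator_of_notMem (by simpa using hx)]
      exact hq0 a x
  have hupp : ∀ (k : Measure ℝ) [IsProbabilityMeasure k] (a : ℝ),
      ∫ x, q a x ∂k ≤ ε * k.real (Set.Iic (a + ε)) := by
    intro k _ a
    rw [← hindv]
    refine integral_mono (hqi k a) (hind k (a + ε)) fun x => ?_
    by_cases hx : x ≤ a + ε
    · rw [Set.indicator_of_mem (Set.mem_Iic.2 hx)]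
      exact hqε a x
    · rw [Set.indicator_of_notMem (by simpa using hx)]
      exact max_le le_rfl ((min_le_right _ _).trans (by linarith))
  -- triangle functions
  have htri : ∀ (a : ℝ) (g : ℝ → ℝ), Continuous g → (∀ x ∈ Set.Ioc a (a + ε), 0 ≤ g x) →
      Integrable ((Set.Ioc a (a + ε)).indicator g) n ∧
      ∫ x, (Set.Ioc a (a + ε)).indicator g x ∂n ≤ C * ∫ x in a..(a + ε), g x := by
    intro a g hg hg0
    have hi : Integrable ((Set.Ioc a (a + ε)).indicator g) :=
      (hg.integrableOn_Ioc).integrable_indicator measurableSet_Ioc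
    refine ⟨(hi.smul_measure ENNReal.ofReal_ne_top).mono_measure hn, ?_⟩
    have := vg_integral_bound hC hn (f := (Set.Ioc a (a + ε)).indicator g)
      (fun x => Set.indicator_nonneg hg0 x) hi
    rw [intervalIntegral.integral_of_le (by linarith), ← integral_indicator measurableSet_Ioc]
    exact this
  have hZ1 : ∀ a, ∫ x, q a x ∂n ≤ ε * n.real (Set.Iic a) + C * (ε ^ 2 / 2) := by
    intro a
    obtain ⟨hi, hb⟩ := htri a (fun x => a + ε - x) (by fun_prop) (fun x hx => by linarith [hx.2])
    have e : ∫ x in a..(a + ε), (a + ε - x) = ε ^ 2 / 2 := by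
      rw [intervalIntegral.integral_sub (by simp) (by simp), intervalIntegral.integral_const,
        integral_id, smul_eq_mul]
      ring
    rw [e] at hb
    rw [← hindv]
    refine le_trans ?_ (add_le_add_right hb _)
    rw [← integral_add (hind n a) hi]
    refine integral_mono (hqi n a) ((hind n a).add hi) fun x => ?_
    by_cases hx : x ≤ a
    · simp [Set.indicator, hx, hqε a x, not_lt.2 hx]
    · push Not at hx
      by_cases hx2 : x ≤ a + ε
      · simp [Set.indicator, hx, hx2, not_le.2 hx, hq]
      · push Not at hx2
        simp [Set.indicator, not_le.2 hx2, not_le.2 hx, hq, hx2.le]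
  have hZ2 : ∀ a, ε * n.real (Set.Iic (a + ε)) ≤ ∫ x, q a x ∂n + C * (ε ^ 2 / 2) := by
    intro a
    obtain ⟨hi, hb⟩ := htri a (fun x => x - a) (by fun_prop) (fun x hx => by linarith [hx.1])
    have e : ∫ x in a..(a + ε), (x - a) = ε ^ 2 / 2 := by
      simp; ring
    rw [e] at hb
    rw [← hindv]
    refine le_trans ?_ (add_le_add_right hb _)
    rw [← integral_add (hqi n a) hi]
    refine integral_mono (hind n (a + ε)) ((hqi n a).add hi) fun x => ?_
    by_cases hx : x ≤ a
    · have : x ≤ a + ε := by linarith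
      have h3 : ε ≤ a + ε - x := by linarith
      simp [Set.indicator, hx, not_lt.2 hx, this, hq, min_eq_left h3]
    · push Not at hx
      by_cases hx2 : x ≤ a + ε
      · have h3 : a + ε - x ≤ ε := by linarith
        simp [Set.indicator, hx, hx2, hq, min_eq_right h3]
      · push Not at hx2
        simp [Set.indicator, not_le.2 hx2, hq]
  have hm1 := abs_le.1 (hd (q z) (hqlip z))
  have hm2 := abs_le.1 (hd (q (z - ε)) (hqlip (z - ε)))
  have a1 := hlow m z
  have a2 := hZ1 z
  have a3 := hupp m (z - ε)
  have a4 := hZ2 (z - ε)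
  rw [sub_add_cancel] at a3 a4
  have e : d / ε + C * ε / 2 = (d + C * (ε ^ 2 / 2)) / ε := by field_simp
  rw [e, le_div_iff₀ hε, ← abs_of_pos hε, ← abs_mul, abs_of_pos hε, abs_le]
  constructor <;> nlinarith

lemma vg_opt {C d x : ℝ} (hC : 0 < C) (h : ∀ ε : ℝ, 0 < ε → x ≤ d / ε + C * ε / 2) :
    x ≤ Real.sqrt (2 * C * d) := by
  rcases le_or_gt x 0 with hx | hx
  · exact hx.trans (Real.sqrt_nonneg _)
  · apply Real.le_sqrt_of_sq_le
    have h1 := h (x / C) (by positivity)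
    have e : d / (x / C) + C * (x / C) / 2 = (C * d) / x + x / 2 := by field_simp
    rw [e] at h1
    have h2 : x / 2 ≤ C * d / x := by linarith
    rw [le_div_iff₀ hx] at h2
    nlinarith

lemma vg_decay_integrable (μ : ℝ) {δ : ℝ} (hδ : 0 < δ) :
    Integrable (fun x : ℝ => (x - μ) * Real.exp (-(δ * |x - μ|))) := by
  have h0 : Integrable (fun x : ℝ => x * Real.exp (-(δ * |x|))) := by
    refine Integrable.mono' (integrable_inv_one_add_sq.const_mul (1 / δ + 6 / δ ^ 3))
      (by fun_prop) (Eventually.of_forall fun u => ?_)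
    rw [norm_mul, Real.norm_eq_abs, Real.norm_eq_abs, abs_of_pos (Real.exp_pos _), Real.exp_neg,
      ← div_eq_mul_inv, ← div_eq_mul_inv, div_le_div_iff₀ (Real.exp_pos _) (by positivity)]
    have hnn : 0 ≤ δ * |u| := by positivity
    have h1 := Real.pow_div_factorial_le_exp (δ * |u|) hnn 1
    have h3 := Real.pow_div_factorial_le_exp (δ * |u|) hnn 3
    norm_num [Nat.factorial] at h1 h3
    have a1 : |u| ≤ 1 / δ * Real.exp (δ * |u|) := by
      rw [div_mul_eq_mul_div, one_mul, le_div_iff₀ hδ]; linarith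
    have a3 : |u| ^ 3 ≤ 6 / δ ^ 3 * Real.exp (δ * |u|) := by
      rw [div_mul_eq_mul_div, le_div_iff₀ (by positivity)]
      rw [mul_pow] at h3; linarith
    have e : |u| * (1 + u ^ 2) = |u| + |u| ^ 3 := by rw [← sq_abs u]; ring
    rw [e]; linarith
  exact h0.comp_sub_right μ

theorem kolmogorov_wasserstein_vg_r_gt_one {Ω : Type*} [MeasurableSpace Ω]
    (P : Measure Ω) [IsProbabilityMeasure P]
    (r θ σ μ : ℝ) (hr : 1 < r) (hσ : 0 < σ)
    (W Z : Ω → ℝ) (hWmeas : Measurable W) (hZmeas : Measurable Z)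
    (hWint : Integrable W P)
    (hlaw : Measure.map Z P =
      MeasureTheory.volume.withDensity (fun x => ENNReal.ofReal (vgDensity r θ σ μ x)))
    (dW : ℝ)
    (hdW : dW = ⨆ f : {f : ℝ → ℝ // LipschitzWith 1 f},
      |(∫ ω, f.1 (W ω) ∂P) - ∫ ω, f.1 (Z ω) ∂P|) :
    (⨆ z : ℝ, |(P {ω | W ω ≤ z}).toReal - (P {ω | Z ω ≤ z}).toReal|) ≤
      Real.sqrt (2 * (Real.Gamma ((r - 1) / 2) /
          (2 * σ * Real.sqrt Real.pi * Real.Gamma (r / 2)) *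
          (σ ^ 2 / (θ ^ 2 + σ ^ 2)) ^ ((r - 1) / 2) *
          Real.exp (θ ^ 2 * max (r - 2) 0 / σ ^ 2)) * dW) := by
  have hG : 0 < Real.Gamma (r / 2) := Real.Gamma_pos_of_pos (by linarith)
  have hG1 : 0 < Real.Gamma ((r - 1) / 2) := Real.Gamma_pos_of_pos (by linarith)
  have hpi : 0 < Real.sqrt Real.pi := Real.sqrt_pos.2 Real.pi_pos
  have hne : ∀ᵐ x : ℝ, x ≠ μ := by
    simp [ae_iff, measure_singleton]
  have hbound := fun x (hx : x ≠ μ) => vgDensity_le (r := r) (θ := θ) (σ := σ) (μ := μ) hr hσ hx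
  set C : ℝ := Real.Gamma ((r - 1) / 2) /
          (2 * σ * Real.sqrt Real.pi * Real.Gamma (r / 2)) *
          (σ ^ 2 / (θ ^ 2 + σ ^ 2)) ^ ((r - 1) / 2) *
          Real.exp (θ ^ 2 * max (r - 2) 0 / σ ^ 2) with hCdef
  have hC : 0 < C := by positivity
  have hn : Measure.map Z P ≤ ENNReal.ofReal C • (volume : Measure ℝ) := by
    rw [hlaw, ← withDensity_const]
    apply withDensity_mono
    filter_upwards [hne] with x hx
    exact ENNReal.ofReal_le_ofReal (hbound x hx)
  have hZint : Integrable Z P := by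
    obtain ⟨D, δ, hD, hδ, hdec⟩ := vgDensity_decay r θ σ μ hr hσ
    have hle : Measure.map Z P ≤ (volume : Measure ℝ).withDensity
        (fun x => ENNReal.ofReal (D * Real.exp (-(δ * |x - μ|)))) := by
      rw [hlaw]
      apply withDensity_mono
      filter_upwards [hne] with x hx
      exact ENNReal.ofReal_le_ofReal (hdec x hx)
    have h1 : Integrable (fun x : ℝ => x - μ) ((volume : Measure ℝ).withDensity
        (fun x => ENNReal.ofReal (D * Real.exp (-(δ * |x - μ|))))) := by
      rw [integrable_withDensity_iff (by fun_prop)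
        (Eventually.of_forall fun x => ENNReal.ofReal_lt_top)]
      refine ((vg_decay_integrable μ hδ).const_mul D).congr (Eventually.of_forall fun x => ?_)
      dsimp only
      rw [ENNReal.toReal_ofReal (by positivity)]; ring
    have h2 := (h1.mono_measure hle).comp_measurable hZmeas
    have h3 := h2.add (integrable_const μ)
    refine h3.congr (Eventually.of_forall fun ω => ?_)
    simp
  have hfint : ∀ (f : ℝ → ℝ), LipschitzWith 1 f → ∀ X : Ω → ℝ, Measurable X → Integrable X P →
      Integrable (fun ω => f (X ω)) P := by
    intro f hf X hX hXi
    refine Integrable.mono' (hXi.abs.add (integrable_const |f 0|))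
      (hf.continuous.measurable.comp hX).aestronglyMeasurable (Eventually.of_forall fun ω => ?_)
    have h1 := hf.dist_le_mul (X ω) 0
    rw [Real.dist_eq, Real.dist_eq] at h1
    simp only [NNReal.coe_one, one_mul, sub_zero] at h1
    rw [Real.norm_eq_abs]
    have h2 := abs_add_le (f (X ω) - f 0) (f 0)
    rw [sub_add_cancel] at h2
    simp only [Pi.add_apply]
    linarith
  have hbdd : BddAbove (Set.range fun f : {f : ℝ → ℝ // LipschitzWith 1 f} =>
      |(∫ ω, f.1 (W ω) ∂P) - ∫ ω, f.1 (Z ω) ∂P|) := by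
    refine ⟨∫ ω, |W ω - Z ω| ∂P, ?_⟩
    rintro _ ⟨⟨f, hf⟩, rfl⟩
    dsimp only
    rw [← integral_sub (hfint f hf W hWmeas hWint) (hfint f hf Z hZmeas hZint)]
    refine (abs_integral_le_integral_abs).trans ?_
    refine integral_mono ((hfint f hf W hWmeas hWint).sub (hfint f hf Z hZmeas hZint)).abs
      (hWint.sub hZint).abs fun ω => ?_
    have h1 := hf.dist_le_mul (W ω) (Z ω)
    rw [Real.dist_eq, Real.dist_eq] at h1
    simpa using h1
  haveI : IsProbabilityMeasure (Measure.map W P) :=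
    Measure.isProbabilityMeasure_map hWmeas.aemeasurable
  haveI : IsProbabilityMeasure (Measure.map Z P) :=
    Measure.isProbabilityMeasure_map hZmeas.aemeasurable
  have hd : ∀ f : ℝ → ℝ, LipschitzWith 1 f →
      |(∫ x, f x ∂(Measure.map W P)) - ∫ x, f x ∂(Measure.map Z P)| ≤ dW := by
    intro f hf
    rw [integral_map hWmeas.aemeasurable hf.continuous.aestronglyMeasurable,
      integral_map hZmeas.aemeasurable hf.continuous.aestronglyMeasurable, hdW]
    exact le_ciSup hbdd ⟨f, hf⟩
  refine ciSup_le fun z => vg_opt hC fun ε hε => ?_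
  have := vg_kol_aux (Measure.map W P) (Measure.map Z P) hC.le hn hd z hε
  rw [measureReal_def, measureReal_def, Measure.map_apply hWmeas measurableSet_Iic,
    Measure.map_apply hZmeas measurableSet_Iic] at this
  exact this
end

section
/- Let r = 1, θ ∈ ℝ, σ > 0, μ ∈ ℝ. Let Z be a real random variable whose law has density p (the VG(1,θ,σ,μ) density) with respect to Lebesgue measure, and let W be any integrable real random variable. Assume 0 < ((θ²+σ²)/σ³)·d_W(W,Z) < 0.755. Then d_K(W,Z) ≤ {5 + log(6/π) + log(σ³/((θ²+σ²)·d_W(W,Z)))}·√(d_W(W,Z)/(6πσ)). -/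
open MeasureTheory Real Filter

lemma aux_tail (T a : ℝ) (hT : 0 < T) (ha : 0 < a) :
    ∫⁻ s in Set.Ioi T, ENNReal.ofReal (2 * Real.cosh s / (a * Real.sinh s ^ 2)) =
      ENNReal.ofReal (2 / (a * Real.sinh T)) := by
  have hpos : ∀ x ∈ Set.Ici T, 0 < Real.sinh x := fun x hx =>
    Real.sinh_pos_iff.2 (lt_of_lt_of_le hT hx)
  have hd : ∀ x ∈ Set.Ici T, HasDerivAt (fun s => -(2 / (a * Real.sinh s)))
      (2 * Real.cosh x / (a * Real.sinh x ^ 2)) x := by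
    intro x hx
    have h0 := hpos x hx
    have h1 := ((Real.hasDerivAt_sinh x).const_mul a)
    have h2 := (((hasDerivAt_const x (2:ℝ)).div h1 (by positivity))).neg
    refine HasDerivAt.congr_deriv (f := fun s => -(2 / (a * Real.sinh s))) h2 ?_
    field_simp
    ring
  have hnn : ∀ x ∈ Set.Ioi T, 0 ≤ 2 * Real.cosh x / (a * Real.sinh x ^ 2) := by
    intro x hx
    have := Real.cosh_pos x
    positivity
  have hsinh : Tendsto Real.sinh atTop atTop :=
    tendsto_atTop_mono' atTop ((eventually_ge_atTop 0).mono fun x hx => Real.self_le_sinh_iff.2 hx)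
      tendsto_id
  have ht : Tendsto (fun s => -(2 / (a * Real.sinh s))) atTop (nhds 0) := by
    have h := (tendsto_const_nhds (x := (2:ℝ))).div_atTop (hsinh.const_mul_atTop ha)
    simpa using h.neg
  rw [← ofReal_integral_eq_lintegral_ofReal (integrableOn_Ioi_deriv_of_nonneg' hd hnn ht)
    ((ae_restrict_iff' measurableSet_Ioi).2 (Eventually.of_forall hnn)),
    integral_Ioi_of_hasDerivAt_of_nonneg' hd hnn ht]
  simp

lemma aux_exp (p q : ℝ) (hp : 0 < p) (hq : 0 < q) (f : ℝ → ℝ)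
    (h1 : ∀ y ≤ 0, f y ≤ Real.exp (p * y)) (h2 : ∀ y, 0 < y → f y ≤ Real.exp (-q * y)) :
    ∫⁻ y, ENNReal.ofReal (f y) ≤ ENNReal.ofReal (1 / p + 1 / q) := by
  rw [← lintegral_add_compl _ (measurableSet_Iic (a := (0:ℝ))), Set.compl_Iic,
    ENNReal.ofReal_add (by positivity) (by positivity)]
  gcongr
  · calc _ ≤ ∫⁻ y in Set.Iic 0, ENNReal.ofReal (Real.exp (p * y)) :=
          setLIntegral_mono' measurableSet_Iic fun y hy => ENNReal.ofReal_le_ofReal (h1 y hy)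
      _ = _ := by
        rw [← ofReal_integral_eq_lintegral_ofReal (integrableOn_exp_mul_Iic hp 0)
          (Eventually.of_forall fun x => (Real.exp_pos _).le), integral_exp_mul_Iic hp]
        simp
  · calc _ ≤ ∫⁻ y in Set.Ioi 0, ENNReal.ofReal (Real.exp (-q * y)) :=
          setLIntegral_mono' measurableSet_Ioi fun y hy => ENNReal.ofReal_le_ofReal (h2 y hy)
      _ = _ := by
        rw [← ofReal_integral_eq_lintegral_ofReal (integrableOn_exp_mul_Ioi (by linarith) 0)
          (Eventually.of_forall fun x => (Real.exp_pos _).le), integral_exp_mul_Ioi (by linarith)]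
        simp

/-- the inner integrand -/
noncomputable def kern (a b μ x s : ℝ) : ℝ :=
  Real.exp (b * (x - μ) - a * |x - μ| * Real.cosh s)

lemma kern_meas (a b μ : ℝ) : Measurable (fun p : ℝ × ℝ => kern a b μ p.1 p.2) := by
  unfold kern
  have : Continuous (fun p : ℝ × ℝ =>
      Real.exp (b * (p.1 - μ) - a * |p.1 - μ| * Real.cosh p.2)) := by fun_prop
  exact this.measurable

lemma kern_le_one (a b μ x s : ℝ) (hab : |b| ≤ a) : kern a b μ x s ≤ 1 := by
  unfold kern
  rw [Real.exp_le_one_iff]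
  have h1 : b * (x - μ) ≤ |b| * |x - μ| := by rw [← abs_mul]; exact le_abs_self _
  have h2 : |b| * |x - μ| ≤ a * |x - μ| := by gcongr
  have h3 : a * |x - μ| * 1 ≤ a * |x - μ| * Real.cosh s := by
    have := abs_nonneg b
    gcongr
    · exact mul_nonneg (by linarith) (abs_nonneg _)
    · exact Real.one_le_cosh s
  linarith

lemma kern_int (a b μ s : ℝ) (ha : 0 < a) (hab : |b| ≤ a) (hs : 0 < s) :
    ∫⁻ x, ENNReal.ofReal (kern a b μ x s) ≤
      ENNReal.ofReal (2 * Real.cosh s / (a * Real.sinh s ^ 2)) := by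
  have hc : 1 < Real.cosh s := Real.one_lt_cosh.2 hs.ne'
  have hsi : 0 < Real.sinh s := Real.sinh_pos_iff.2 hs
  have hsq := Real.cosh_sq s
  obtain ⟨hb1, hb2⟩ := abs_le.1 hab
  have hac : a < a * Real.cosh s := by nlinarith
  have e : ∫⁻ x, ENNReal.ofReal (kern a b μ x s) = ∫⁻ x, ENNReal.ofReal (kern a b 0 x s) := by
    have := lintegral_sub_right_eq_self (μ := volume)
      (fun x => ENNReal.ofReal (kern a b 0 x s)) μ
    rw [← this]
    simp [kern]
  rw [e]
  refine (aux_exp (a * Real.cosh s + b) (a * Real.cosh s - b) (by linarith) (by linarith) _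
    ?_ ?_).trans ?_
  · intro y hy
    unfold kern
    rw [Real.exp_le_exp, sub_zero, abs_of_nonpos hy]
    apply le_of_eq; ring
  · intro y hy
    unfold kern
    rw [Real.exp_le_exp, sub_zero, abs_of_pos hy]
    apply le_of_eq; ring
  · apply ENNReal.ofReal_le_ofReal
    have hp : 0 < a * Real.cosh s + b := by linarith
    have hq : 0 < a * Real.cosh s - b := by linarith
    rw [div_add_div _ _ hp.ne' hq.ne', div_le_div_iff₀ (by positivity) (by positivity)]
    have hb : b ^ 2 ≤ a ^ 2 := by nlinarith
    have : (a * Real.cosh s + b) * (a * Real.cosh s - b) ≥ a ^ 2 * Real.sinh s ^ 2 := by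
      nlinarith
    have hcp : 0 < Real.cosh s := by linarith
    calc _ = 2 * Real.cosh s * (a ^ 2 * Real.sinh s ^ 2) := by ring
      _ ≤ _ := by gcongr

lemma kern_w (a b μ α T : ℝ) (ha : 0 < a) (hab : |b| ≤ a) (hT : 0 < T) (hα : 0 < α)
    (w : ℝ → ENNReal) (hw : Measurable w) (hw1 : ∀ x, w x ≤ 1)
    (hwi : ∫⁻ x, w x ≤ ENNReal.ofReal (α / 2)) :
    ∫⁻ x, (∫⁻ s in Set.Ioi 0, ENNReal.ofReal (kern a b μ x s)) * w x ≤
      ENNReal.ofReal (α * T / 2 + 2 / (a * Real.sinh T)) := by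
  have hsi : 0 < Real.sinh T := Real.sinh_pos_iff.2 hT
  have hm : Measurable (fun p : ℝ × ℝ => ENNReal.ofReal (kern a b μ p.1 p.2)) :=
    (kern_meas a b μ).ennreal_ofReal
  have e1 : ∫⁻ x, (∫⁻ s in Set.Ioi 0, ENNReal.ofReal (kern a b μ x s)) * w x =
      ∫⁻ s in Set.Ioi 0, ∫⁻ x, ENNReal.ofReal (kern a b μ x s) * w x := by
    rw [← lintegral_lintegral_swap]
    · refine lintegral_congr fun x => ?_
      rw [lintegral_mul_const]
      exact hm.comp (measurable_const.prodMk measurable_id)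
    · exact (hm.mul (hw.comp measurable_fst)).aemeasurable
  rw [e1, ← Set.Ioc_union_Ioi_eq_Ioi hT.le]
  refine (lintegral_union_le _ _ _).trans ?_
  rw [ENNReal.ofReal_add (by positivity) (by positivity)]
  gcongr
  · calc _ ≤ ∫⁻ s in Set.Ioc 0 T, ENNReal.ofReal (α / 2) := by
          refine lintegral_mono fun s => le_trans (lintegral_mono fun x => ?_) hwi
          calc _ ≤ 1 * w x := by
                gcongr
                exact ENNReal.ofReal_le_one.2 (kern_le_one a b μ x s hab)
            _ = w x := one_mul _
      _ = _ := by
          rw [setLIntegral_const, Real.volume_Ioc, ← ENNReal.ofReal_mul (by positivity)]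
          congr 1; ring
  · rw [← aux_tail T a hT ha]
    refine setLIntegral_mono' measurableSet_Ioi fun s hs => ?_
    refine le_trans (lintegral_mono fun x => ?_) (kern_int a b μ s ha hab (hT.trans hs))
    calc _ ≤ ENNReal.ofReal (kern a b μ x s) * 1 := by gcongr; exact hw1 x
      _ = _ := mul_one _

lemma vg_le (θ σ μ x : ℝ) (hσ : 0 < σ) :
    ENNReal.ofReal (vgDensity 1 θ σ μ x) ≤ ENNReal.ofReal (1 / (π * σ)) *
      ∫⁻ s in Set.Ioi 0,
        ENNReal.ofReal (kern (Real.sqrt (θ ^ 2 + σ ^ 2) / σ ^ 2) (θ / σ ^ 2) μ x s) := by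
  have e : vgDensity 1 θ σ μ x = (1 / (π * σ)) * ∫ s in Set.Ioi 0,
      kern (Real.sqrt (θ ^ 2 + σ ^ 2) / σ ^ 2) (θ / σ ^ 2) μ x s := by
    unfold vgDensity besselK
    rw [Real.Gamma_one_half_eq, mul_assoc σ, Real.mul_self_sqrt Real.pi_pos.le]
    simp only [sub_self, zero_div, Real.rpow_zero, mul_one, zero_mul, Real.cosh_zero]
    rw [mul_assoc, ← integral_const_mul]
    congr 1
    · rw [one_div, mul_comm]
    · refine integral_congr_ae (Eventually.of_forall fun s => ?_)
      simp only [kern]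
      rw [← Real.exp_add]
      congr 1; ring
  rw [e, ENNReal.ofReal_mul (by positivity)]
  gcongr
  have hm : Measurable (fun s => kern (Real.sqrt (θ ^ 2 + σ ^ 2) / σ ^ 2) (θ / σ ^ 2) μ x s) :=
    (kern_meas _ _ μ).comp (measurable_const.prodMk measurable_id)
  rw [integral_eq_lintegral_of_nonneg_ae
    (f := fun s => kern (Real.sqrt (θ ^ 2 + σ ^ 2) / σ ^ 2) (θ / σ ^ 2) μ x s)
    (Eventually.of_forall fun s => (Real.exp_pos _).le) hm.aestronglyMeasurable]
  exact ENNReal.ofReal_toReal_le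

lemma exp_w {Ω : Type*} [MeasurableSpace Ω]
    (P : Measure Ω) [IsProbabilityMeasure P]
    (θ σ μ : ℝ) (hσ : 0 < σ) (Z : Ω → ℝ) (hZmeas : Measurable Z)
    (hlaw : Measure.map Z P =
      MeasureTheory.volume.withDensity (fun x => ENNReal.ofReal (vgDensity 1 θ σ μ x)))
    (α T : ℝ) (hT : 0 < T) (hα : 0 < α)
    (w : ℝ → ℝ) (hw : Measurable w) (hw0 : ∀ x, 0 ≤ w x) (hw1 : ∀ x, w x ≤ 1)
    (hwi : ∫⁻ x, ENNReal.ofReal (w x) ≤ ENNReal.ofReal (α / 2)) :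
    ∫ ω, w (Z ω) ∂P ≤ 1 / (π * σ) *
      (α * T / 2 + 2 / (Real.sqrt (θ ^ 2 + σ ^ 2) / σ ^ 2 * Real.sinh T)) := by
  set a := Real.sqrt (θ ^ 2 + σ ^ 2) / σ ^ 2 with ha
  set b := θ / σ ^ 2 with hb
  have ha0 : 0 < a := by positivity
  have hab : |b| ≤ a := by
    rw [hb, ha, abs_div, abs_of_pos (by positivity : 0 < σ ^ 2)]
    gcongr
    apply Real.abs_le_sqrt
    nlinarith
  have hsi : 0 < Real.sinh T := Real.sinh_pos_iff.2 hT
  rw [integral_eq_lintegral_of_nonneg_ae (Eventually.of_forall fun ω => hw0 _)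
    (hw.comp hZmeas).aestronglyMeasurable]
  refine ENNReal.toReal_le_of_le_ofReal (by positivity) ?_
  have hkm : Measurable (fun x => ∫⁻ s in Set.Ioi 0, ENNReal.ofReal (kern a b μ x s)) :=
    Measurable.lintegral_prod_right' (f := fun p : ℝ × ℝ => ENNReal.ofReal (kern a b μ p.1 p.2))
      (kern_meas a b μ).ennreal_ofReal
  have e1 : ∫⁻ ω, ENNReal.ofReal (w (Z ω)) ∂P =
      ∫⁻ x, ENNReal.ofReal (w x) ∂(Measure.map Z P) :=
    (lintegral_map (f := fun x => ENNReal.ofReal (w x)) hw.ennreal_ofReal hZmeas).symm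
  rw [e1, hlaw]
  calc _ ≤ ∫⁻ x, ENNReal.ofReal (w x) ∂(volume.withDensity (fun x =>
        ENNReal.ofReal (1 / (π * σ)) * ∫⁻ s in Set.Ioi 0, ENNReal.ofReal (kern a b μ x s))) :=
        lintegral_mono' (withDensity_mono (Eventually.of_forall fun x => vg_le θ σ μ x hσ)) le_rfl
    _ = ENNReal.ofReal (1 / (π * σ)) *
        ∫⁻ x, (∫⁻ s in Set.Ioi 0, ENNReal.ofReal (kern a b μ x s)) * ENNReal.ofReal (w x) := by
        rw [lintegral_withDensity_eq_lintegral_mul _ (hkm.const_mul _) hw.ennreal_ofReal,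
          ← lintegral_const_mul (f := fun x => (∫⁻ s in Set.Ioi 0, ENNReal.ofReal (kern a b μ x s)) *
            ENNReal.ofReal (w x)) _ (hkm.mul hw.ennreal_ofReal)]
        refine lintegral_congr fun x => ?_
        simp only [Pi.mul_apply]
        rw [mul_assoc]
    _ ≤ _ := by
        rw [ENNReal.ofReal_mul (by positivity)]
        gcongr
        exact kern_w a b μ α T ha0 hab hT hα _ hw.ennreal_ofReal
          (fun x => ENNReal.ofReal_le_one.2 (hw1 x)) hwi

/-- smoothed indicator of `(-∞, c]` -/
noncomputable def hfun (c α x : ℝ) : ℝ := max 0 (min 1 ((c + α - x) / α))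

lemma hfun_cont (c α : ℝ) : Continuous (hfun c α) := by
  unfold hfun; fun_prop

lemma hfun_lip (c α : ℝ) (hα : 0 < α) : LipschitzWith 1 (fun x => α * hfun c α x) := by
  have e : (fun x => α * hfun c α x) = fun x => max 0 (min α (c + α - x)) := by
    funext x
    unfold hfun
    rw [mul_max_of_nonneg _ _ hα.le, mul_min_of_nonneg _ _ hα.le, mul_zero, mul_one,
      mul_div_cancel₀ _ hα.ne']
  rw [e]
  apply LipschitzWith.const_max
  apply LipschitzWith.const_min
  apply LipschitzWith.of_dist_le_mul
  intro x y
  simp only [Real.dist_eq, NNReal.coe_one, one_mul]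
  rw [abs_sub_comm x y]
  apply le_of_eq; congr 1; ring

lemma hfun_nonneg (c α x : ℝ) : 0 ≤ hfun c α x := le_max_left _ _

lemma hfun_le_one (c α x : ℝ) : hfun c α x ≤ 1 := max_le zero_le_one (min_le_left _ _)

lemma hfun_left (c α x : ℝ) (hα : 0 < α) (hx : x ≤ c) : hfun c α x = 1 := by
  unfold hfun
  have : 1 ≤ (c + α - x) / α := by rw [le_div_iff₀ hα]; linarith
  rw [min_eq_left this]; simp

lemma hfun_right (c α x : ℝ) (hα : 0 < α) (hx : c + α ≤ x) : hfun c α x = 0 := by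
  unfold hfun
  have : (c + α - x) / α ≤ 0 := div_nonpos_of_nonpos_of_nonneg (by linarith) hα.le
  exact max_eq_left ((min_le_right _ _).trans this)

lemma hfun_mid (c α x : ℝ) (hα : 0 < α) (hx : c ≤ x) (hx' : x ≤ c + α) :
    hfun c α x = (c + α - x) / α := by
  unfold hfun
  rw [min_eq_right, max_eq_right]
  · exact div_nonneg (by linarith) hα.le
  · rw [div_le_one hα]; linarith

lemma w_int (c α : ℝ) (hα : 0 < α) (w g : ℝ → ℝ) (hg : Continuous g)
    (hg0 : ∀ x ∈ Set.Icc c (c + α), 0 ≤ g x)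
    (hgi : ∫ x in c..(c + α), g x = α / 2)
    (h : ∀ x, x ∉ Set.Icc c (c + α) → w x = 0) (h' : ∀ x ∈ Set.Icc c (c + α), w x ≤ g x) :
    ∫⁻ x, ENNReal.ofReal (w x) ≤ ENNReal.ofReal (α / 2) := by
  calc _ = ∫⁻ x in Set.Icc c (c + α), ENNReal.ofReal (w x) := by
        rw [setLIntegral_eq_of_support_subset]
        intro x hx
        by_contra hc
        simp [h x hc] at hx
    _ ≤ ∫⁻ x in Set.Icc c (c + α), ENNReal.ofReal (g x) :=
        setLIntegral_mono' measurableSet_Icc fun x hx => ENNReal.ofReal_le_ofReal (h' x hx)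
    _ = _ := by
        rw [← hgi, intervalIntegral.integral_of_le (by linarith), ← integral_Icc_eq_integral_Ioc,
          ofReal_integral_eq_lintegral_ofReal hg.continuousOn.integrableOn_Icc
          ((ae_restrict_iff' measurableSet_Icc).2 (Eventually.of_forall hg0))]

lemma num_bound (A δ : ℝ) (hA : 0 < A) (hAδ : 2 * π * δ = 3 * A ^ 2) (hδ : δ < 0.755) :
    8 / A > 1 ∧
    Real.log (8 / A) + 4 / (A * Real.sinh (Real.log (8 / A))) ≤
      2 + Real.log (6 / π) + Real.log (1 / δ) := by
  have hpi := Real.pi_lt_d4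
  have hpi0 := Real.pi_pos
  have hδ0 : 0 < δ := by
    have : 0 < 2 * π * δ := by rw [hAδ]; positivity
    exact pos_of_mul_pos_right this (by positivity)
  have hA2 : A ^ 2 < 1.5815 := by nlinarith
  have hA3 : A < 2 := by nlinarith
  refine ⟨by rw [gt_iff_lt, lt_div_iff₀ hA]; linarith, ?_⟩
  have e1 : 4 / (A * Real.sinh (Real.log (8 / A))) = 64 / (64 - A ^ 2) := by
    rw [Real.sinh_log (by positivity)]
    have : 64 - A ^ 2 ≠ 0 := by nlinarith
    have h2 : A * ((8 / A - (8 / A)⁻¹) / 2) = (64 - A ^ 2) / 16 := by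
      field_simp
      ring
    rw [h2]
    field_simp
    norm_num
  have e2 : 64 / (64 - A ^ 2) ≤ 1.026 := by
    rw [div_le_iff₀ (by nlinarith)]; nlinarith
  have e3 : Real.log (6 / π) + Real.log (1 / δ) = 2 * Real.log 2 - 2 * Real.log A := by
    rw [← Real.log_mul (by positivity) (by positivity)]
    have : 6 / π * (1 / δ) = 2 ^ 2 / A ^ 2 := by
      field_simp
      linarith
    rw [this, Real.log_div (by positivity) (by positivity), Real.log_pow, Real.log_pow]
    push_cast; ring
  have e4 : Real.log (8 / A) = 3 * Real.log 2 - Real.log A := by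
    rw [Real.log_div (by positivity) hA.ne', show (8:ℝ) = 2 ^ 3 by norm_num, Real.log_pow]
    push_cast; ring
  have e5 : 2 * Real.log A ≤ Real.log 2 + (A ^ 2 / 2 - 1) := by
    have h := Real.log_le_sub_one_of_pos (x := A ^ 2 / 2) (by positivity)
    rw [Real.log_div (by positivity) (by positivity), Real.log_pow] at h
    push_cast at h
    linarith
  have hl := Real.log_two_lt_d9
  rw [e1, e4, add_assoc, e3]
  linarith

theorem kolmogorov_wasserstein_vg_r_eq_one {Ω : Type*} [MeasurableSpace Ω]
    (P : Measure Ω) [IsProbabilityMeasure P]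
    (θ σ μ : ℝ) (hσ : 0 < σ)
    (W Z : Ω → ℝ) (hWmeas : Measurable W) (hZmeas : Measurable Z)
    (hWint : Integrable W P)
    (hlaw : Measure.map Z P =
      MeasureTheory.volume.withDensity (fun x => ENNReal.ofReal (vgDensity 1 θ σ μ x)))
    (dW : ℝ)
    (hdW : dW = ⨆ f : {f : ℝ → ℝ // LipschitzWith 1 f},
      |(∫ ω, f.1 (W ω) ∂P) - ∫ ω, f.1 (Z ω) ∂P|)
    (hpos : 0 < (θ ^ 2 + σ ^ 2) / σ ^ 3 * dW)
    (hsmall : (θ ^ 2 + σ ^ 2) / σ ^ 3 * dW < 0.755) :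
    (⨆ z : ℝ, |(P {ω | W ω ≤ z}).toReal - (P {ω | Z ω ≤ z}).toReal|) ≤
      (5 + Real.log (6 / Real.pi) + Real.log (σ ^ 3 / ((θ ^ 2 + σ ^ 2) * dW))) *
        Real.sqrt (dW / (6 * Real.pi * σ)) := by
  have hS : 0 < θ ^ 2 + σ ^ 2 := by positivity
  have hd0 : 0 < dW := pos_of_mul_pos_right hpos (by positivity)
  -- the supremum is genuine
  have hbdd : BddAbove (Set.range fun f : {f : ℝ → ℝ // LipschitzWith 1 f} =>
      |(∫ ω, f.1 (W ω) ∂P) - ∫ ω, f.1 (Z ω) ∂P|) := by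
    by_contra hc
    have := Real.iSup_of_not_bddAbove hc
    rw [this] at hdW
    linarith
  have hlip : ∀ f : ℝ → ℝ, LipschitzWith 1 f →
      |(∫ ω, f (W ω) ∂P) - ∫ ω, f (Z ω) ∂P| ≤ dW := by
    intro f hf
    rw [hdW]
    exact le_ciSup hbdd ⟨f, hf⟩
  set q := Real.sqrt (dW / (6 * π * σ)) with hq
  have hq0 : 0 < q := Real.sqrt_pos.2 (by positivity)
  have hq2 : q ^ 2 = dW / (6 * π * σ) := Real.sq_sqrt (by positivity)
  have hdq : dW = 6 * π * σ * q ^ 2 := by rw [hq2]; field_simp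
  set a := Real.sqrt (θ ^ 2 + σ ^ 2) / σ ^ 2 with ha
  have ha0 : 0 < a := by positivity
  have ha2 : a ^ 2 = (θ ^ 2 + σ ^ 2) / σ ^ 4 := by
    rw [ha, div_pow, Real.sq_sqrt hS.le]; ring
  set α := 2 * π * σ * q with hα
  have hα0 : 0 < α := by positivity
  set A := a * α with hA
  have hA0 : 0 < A := by positivity
  set δ := (θ ^ 2 + σ ^ 2) / σ ^ 3 * dW with hδ
  have hAδ : 2 * π * δ = 3 * A ^ 2 := by
    rw [hδ, hA, mul_pow, ha2, hα, hdq]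
    field_simp
    ring
  obtain ⟨hT1, hnum⟩ := num_bound A δ hA0 hAδ hsmall
  set T := Real.log (8 / A) with hT
  have hT0 : 0 < T := Real.log_pos hT1
  have hsi : 0 < Real.sinh T := Real.sinh_pos_iff.2 hT0
  have hB := exp_w P θ σ μ hσ Z hZmeas hlaw α T hT0 hα0
  rw [← ha] at hB
  have hfin : dW / α + 1 / (π * σ) * (α * T / 2 + 2 / (a * Real.sinh T)) ≤
      (5 + Real.log (6 / π) + Real.log (σ ^ 3 / ((θ ^ 2 + σ ^ 2) * dW))) * q := by
    have e1 : dW / α + 1 / (π * σ) * (α * T / 2 + 2 / (a * Real.sinh T)) =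
        (3 + (T + 4 / (A * Real.sinh T))) * q := by
      rw [hA, hα, hdq]
      field_simp
      ring
    have e2 : σ ^ 3 / ((θ ^ 2 + σ ^ 2) * dW) = 1 / δ := by
      rw [hδ]; field_simp
    rw [e1, e2]
    refine mul_le_mul_of_nonneg_right ?_ hq0.le
    linarith
  -- Lipschitz comparison
  have hcomp : ∀ c, |(∫ ω, hfun c α (W ω) ∂P) - ∫ ω, hfun c α (Z ω) ∂P| ≤ dW / α := by
    intro c
    have h := hlip _ (hfun_lip c α hα0)
    simp only [integral_const_mul] at h
    rw [← mul_sub, abs_mul, abs_of_pos hα0] at h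
    rw [le_div_iff₀ hα0]; linarith
  have hint : ∀ (Y : Ω → ℝ), Measurable Y → ∀ c, Integrable (fun ω => hfun c α (Y ω)) P := by
    intro Y hY c
    refine Integrable.of_bound
      ((hfun_cont c α).measurable.comp hY).aestronglyMeasurable 1 (Eventually.of_forall fun ω => ?_)
    rw [Real.norm_eq_abs, abs_of_nonneg (hfun_nonneg _ _ _)]
    exact hfun_le_one _ _ _
  let I : ℝ → ℝ → ℝ := fun z => Set.indicator (Set.Iic z) 1
  have hImeas : ∀ z, Measurable (I z) := fun z => measurable_one.indicator measurableSet_Iic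
  have hIint : ∀ (Y : Ω → ℝ), Measurable Y → ∀ z, Integrable (fun ω => I z (Y ω)) P := by
    intro Y hY z
    refine Integrable.of_bound ((hImeas z).comp hY).aestronglyMeasurable 1
      (Eventually.of_forall fun ω => ?_)
    by_cases h : Y ω ≤ z <;> simp [I, h]
  have hIval : ∀ (Y : Ω → ℝ), Measurable Y → ∀ z,
      (P {ω | Y ω ≤ z}).toReal = ∫ ω, I z (Y ω) ∂P := by
    intro Y hY z
    have : (fun ω => I z (Y ω)) = Set.indicator {ω | Y ω ≤ z} 1 := by
      funext ω
      by_cases h : Y ω ≤ z <;> simp [I, h]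
    have hms : MeasurableSet {ω | Y ω ≤ z} := hY measurableSet_Iic
    rw [this, integral_indicator_one hms]
    rfl
  have hI1 : ∀ z x, x ≤ z → I z x = 1 := fun z x h => by simp [I, h]
  have hI0 : ∀ z x, ¬ x ≤ z → I z x = 0 := fun z x h => by simp [I, h]
  -- comparisons of indicators
  have hle1 : ∀ z x, I z x ≤ hfun z α x := by
    intro z x
    by_cases h : x ≤ z
    · rw [hI1 z x h, hfun_left z α x hα0 h]
    · rw [hI0 z x h]; exact hfun_nonneg _ _ _
  have hle2 : ∀ z x, hfun (z - α) α x ≤ I z x := by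
    intro z x
    by_cases h : x ≤ z
    · rw [hI1 z x h]; exact hfun_le_one _ _ _
    · rw [hI0 z x h, hfun_right _ _ _ hα0 (by linarith)]
  have hIle : ∀ z x, I z x ≤ 1 := by
    intro z x
    by_cases h : x ≤ z <;> simp [I, h]
  have hInn : ∀ z x, 0 ≤ I z x := by
    intro z x
    by_cases h : x ≤ z <;> simp [I, h]
  refine ciSup_le fun z => le_trans ?_ hfin
  rw [hIval W hWmeas, hIval Z hZmeas, abs_le]
  constructor
  · have hw := hB (fun x => I z x - hfun (z - α) α x)
      ((hImeas z).sub (hfun_cont _ _).measurable)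
      (fun x => sub_nonneg.2 (hle2 z x))
      (fun x => by have := hIle z x; have := hfun_nonneg (z - α) α x; linarith)
      (by
        refine w_int (z - α) α hα0 _ (fun x => (x - (z - α)) / α) (by fun_prop) ?_ ?_ ?_ ?_
        · intro x hx
          exact div_nonneg (by linarith [hx.1]) hα0.le
        · rw [intervalIntegral.integral_div, intervalIntegral.integral_sub (by simp) (by simp)]
          simp only [integral_id, intervalIntegral.integral_const, smul_eq_mul]
          field_simp
          ring
        · intro x hx
          simp only [Set.mem_Icc, not_and_or, not_le] at hx
          rcases hx with hx | hx
          · rw [hI1 z x (by linarith), hfun_left _ _ _ hα0 hx.le, sub_self]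
          · rw [hI0 z x (by linarith), hfun_right _ _ _ hα0 hx.le, sub_self]
        · intro x hx
          rw [hfun_mid _ _ _ hα0 hx.1 hx.2, hI1 z x (by linarith [hx.2])]
          apply le_of_eq
          field_simp
          ring)
    rw [integral_sub (hIint Z hZmeas z) (hint Z hZmeas _)] at hw
    have h1 := (abs_le.1 (hcomp (z - α))).1
    have h2 : ∫ ω, hfun (z - α) α (W ω) ∂P ≤ ∫ ω, I z (W ω) ∂P :=
      integral_mono (hint W hWmeas _) (hIint W hWmeas z) fun ω => hle2 z _
    linarith
  · have hw := hB (fun x => hfun z α x - I z x)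
      ((hfun_cont _ _).measurable.sub (hImeas z))
      (fun x => sub_nonneg.2 (hle1 z x))
      (fun x => by have := hInn z x; have := hfun_le_one z α x; linarith)
      (by
        refine w_int z α hα0 _ (fun x => (z + α - x) / α) (by fun_prop) ?_ ?_ ?_ ?_
        · intro x hx
          exact div_nonneg (by linarith [hx.2]) hα0.le
        · rw [intervalIntegral.integral_div, intervalIntegral.integral_sub (by simp) (by simp)]
          simp only [integral_id, intervalIntegral.integral_const, smul_eq_mul]
          field_simp
          ring
        · intro x hx
          simp only [Set.mem_Icc, not_and_or, not_le] at hx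
          rcases hx with hx | hx
          · rw [hI1 z x hx.le, hfun_left _ _ _ hα0 hx.le, sub_self]
          · rw [hI0 z x (by linarith), hfun_right _ _ _ hα0 hx.le, sub_self]
        · intro x hx
          rw [hfun_mid _ _ _ hα0 hx.1 hx.2]
          have := hInn z x
          linarith)
    rw [integral_sub (hint Z hZmeas _) (hIint Z hZmeas z)] at hw
    have h1 := (abs_le.1 (hcomp z)).2
    have h2 : ∫ ω, I z (W ω) ∂P ≤ ∫ ω, hfun z α (W ω) ∂P :=
      integral_mono (hIint W hWmeas z) (hint W hWmeas _) fun ω => hle1 z _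
    linarith
end
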